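/- arXiv:1504.01212 — 6 statements merged into one kernel-verified Lean document; each statement's English description precedes it below -/
import Mathlib

section
/- Let P, T ∈ (0,∞). Let g : [0,T] → [0,∞) be measurable with ∫₀ᵀ g(t)² dt < ∞, and let Φ : [0,T] → ℝ be monotone decreasing. Define f : [0,T] → ℝ by f(t) = P·min{1, g(t)⁻²·Φ(t)²} when g(t) > 0 and f(t) = P when g(t) = 0, and assume that Φ(t₂) − Φ(t₁) ≤ −∫_{t₁}^{t₂} f(t) dt for all 0 ≤ t₁ < t₂ ≤ T. If Φ(0) ≤ PT/8, then Φ(T) ≤ (8/(P·T²))·∫₀ᵀ g(t)² dt. -/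
open MeasureTheory Set

/-- Part (1) of the ODE Lemma (Lemma 4.3). -/
theorem ode_lemma_part1 (P T : ℝ) (hP : 0 < P) (hT : 0 < T)
    (g Φ f : ℝ → ℝ)
    (hg_meas : Measurable g)
    (hg_nonneg : ∀ t ∈ Icc (0:ℝ) T, 0 ≤ g t)
    (hg_L2 : IntervalIntegrable (fun t => (g t) ^ 2) volume 0 T)
    (hΦ_mono : AntitoneOn Φ (Icc (0:ℝ) T))
    (hf : ∀ t, f t = if g t = 0 then P else P * min 1 ((g t)⁻¹ ^ 2 * (Φ t) ^ 2))
    (hΦ_ineq : ∀ t₁ t₂, 0 ≤ t₁ → t₁ < t₂ → t₂ ≤ T →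
      Φ t₂ - Φ t₁ ≤ - ∫ t in t₁..t₂, f t)
    (hΦ0 : Φ 0 ≤ P * T / 8) :
    Φ T ≤ (8 / (P * T ^ 2)) * ∫ t in (0:ℝ)..T, (g t) ^ 2 := by
  by_contra hcon
  push Not at hcon
  set G := ∫ t in (0:ℝ)..T, (g t) ^ 2 with hG
  have hG0 : 0 ≤ G := intervalIntegral.integral_nonneg hT.le (fun t _ => sq_nonneg _)
  have hΦT : 0 < Φ T := lt_of_le_of_lt (by positivity) hcon
  have hf0 : ∀ t, 0 ≤ f t := by
    intro t
    rw [hf]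
    split_ifs <;> positivity
  have hfP : ∀ t, f t ≤ P := by
    intro t
    rw [hf]
    split_ifs
    · exact le_rfl
    · exact mul_le_of_le_one_right hP.le (min_le_left _ _)
  have hΦmeas : AEMeasurable Φ (volume.restrict (Icc 0 T)) :=
    aemeasurable_restrict_of_antitoneOn measurableSet_Icc hΦ_mono
  have hfmeas : AEMeasurable f (volume.restrict (Icc 0 T)) := by
    have : f = fun t => {t | g t = 0}.indicator (fun _ => P) t +
        {t | g t = 0}ᶜ.indicator (fun t => P * min 1 ((g t)⁻¹ ^ 2 * (Φ t) ^ 2)) t := by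
      ext t
      rw [hf]
      by_cases h : g t = 0 <;> simp [h]
    rw [this]
    have hS : MeasurableSet {t | g t = 0} := hg_meas (measurableSet_singleton 0)
    refine AEMeasurable.add (AEMeasurable.indicator aemeasurable_const hS)
      (AEMeasurable.indicator ?_ hS.compl)
    exact (aemeasurable_const.min
      ((hg_meas.inv.pow_const 2).aemeasurable.mul (hΦmeas.pow_const 2))).const_mul P
  have hfint : IntervalIntegrable f volume 0 T := by
    rw [intervalIntegrable_iff_integrableOn_Icc_of_le hT.le]
    refine Integrable.of_bound hfmeas.aestronglyMeasurable P ?_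
    refine Filter.Eventually.of_forall fun t => ?_
    rw [Real.norm_eq_abs, abs_of_nonneg (hf0 t)]
    exact hfP t
  have hfsub : ∀ a b, 0 ≤ a → a ≤ b → b ≤ T → IntervalIntegrable f volume a b := by
    intro a b ha hab hb
    apply hfint.mono_set
    rw [uIcc_of_le hab, uIcc_of_le hT.le]
    exact Icc_subset_Icc ha hb
  set I := ∫ t in (0:ℝ)..T, f t with hI
  have hIle : I ≤ P * T / 8 := by
    have := hΦ_ineq 0 T le_rfl hT le_rfl
    linarith
  let F : ℝ → ℝ := fun t => Φ T + I - ∫ s in (0:ℝ)..t, f s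
  have hFeq : ∀ t ∈ Icc 0 T, F t = Φ T + ∫ s in t..T, f s := by
    intro t ht
    have := intervalIntegral.integral_add_adjacent_intervals
      (hfsub 0 t le_rfl ht.1 ht.2) (hfsub t T ht.1 ht.2 le_rfl)
    simp only [F, hI]
    linarith
  have hFge : ∀ t ∈ Icc 0 T, Φ T ≤ F t := by
    intro t ht
    rw [hFeq t ht]
    have := intervalIntegral.integral_nonneg (μ := volume) ht.2 (fun s _ => hf0 s)
    linarith
  have hFle : ∀ t ∈ Icc 0 T, F t ≤ Φ t := by
    intro t ht
    rw [hFeq t ht]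
    rcases ht.2.eq_or_lt with h | h
    · subst h; simp
    · have := hΦ_ineq t T ht.1 h le_rfl
      linarith
  have hFanti : ∀ a ∈ Icc 0 T, ∀ b ∈ Icc 0 T, a ≤ b → F b ≤ F a := by
    intro a ha b hb hab
    have h1 := intervalIntegral.integral_add_adjacent_intervals
      (hfsub 0 a le_rfl ha.1 ha.2) (hfsub a b ha.1 hab hb.2)
    have h2 := intervalIntegral.integral_nonneg (μ := volume) hab (fun s _ => hf0 s)
    simp only [F]
    linarith
  let u : ℝ → ℝ := fun t => (F t)⁻¹
  have hu : MonotoneOn u (uIcc 0 T) := by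
    rw [uIcc_of_le hT.le]
    intro a ha b hb hab
    exact inv_anti₀ (hΦT.trans_le (hFge b hb)) (hFanti a ha b hb hab)
  have huint := hu.intervalIntegrable_deriv
  have hule : ∫ x in (0:ℝ)..T, deriv u x ≤ (Φ T)⁻¹ := by
    have h1 := hu.intervalIntegral_deriv_mem_uIcc
    have h0 : (0:ℝ) ∈ Icc 0 T := ⟨le_rfl, hT.le⟩
    have hTT : T ∈ Icc 0 T := ⟨hT.le, le_rfl⟩
    have h2 : u 0 ≤ u T := hu (by simp) (by simp) hT.le
    rw [uIcc_of_le (by linarith)] at h1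
    have h3 : u T = (Φ T)⁻¹ := by simp [u, F, hI]
    have h4 : 0 ≤ u 0 := inv_nonneg.2 (hΦT.le.trans (hFge 0 h0))
    linarith [h1.2]
  have huderiv : ∀ᵐ x, x ∈ uIcc 0 T → HasDerivAt u (f x / (F x) ^ 2) x := by
    filter_upwards [hfint.ae_hasDerivAt_integral] with x hx hxm
    have h1 := hx hxm 0 (by simp)
    rw [uIcc_of_le hT.le] at hxm
    have hne : F x ≠ 0 := (hΦT.trans_le (hFge x hxm)).ne'
    have h2 : HasDerivAt F (-f x) x := by simpa [F] using h1.const_sub (Φ T + I)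
    have := h2.inv hne
    rw [neg_neg] at this
    exact this
  obtain ⟨lam, hlam⟩ : ∃ lam, lam = 1 / (P * T * Φ T) := ⟨_, rfl⟩
  have hlam0 : 0 < lam := by rw [hlam]; positivity
  have key : ∀ᵐ x, x ∈ Icc 0 T →
      P * (2 * lam - lam ^ 2 * (g x) ^ 2) ≤ deriv u x + 2 * lam * f x := by
    filter_upwards [huderiv] with x hx hxm
    rw [(hx (by rwa [uIcc_of_le hT.le])).deriv]
    have hFx : 0 < F x := hΦT.trans_le (hFge x hxm)
    have hFΦ := hFle x hxm
    have hg0 := hg_nonneg x hxm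
    have hq : 0 ≤ f x / (F x) ^ 2 := div_nonneg (hf0 x) (sq_nonneg _)
    have hl2 : 0 ≤ P * (lam ^ 2 * g x ^ 2) := by positivity
    have caseA : f x = P → P * (2 * lam - lam ^ 2 * (g x) ^ 2) ≤
        f x / (F x) ^ 2 + 2 * lam * f x := by
      intro h
      rw [h] at hq ⊢
      nlinarith
    by_cases h : g x = 0
    · exact caseA (by rw [hf, if_pos h])
    · rcases le_total 1 ((g x)⁻¹ ^ 2 * (Φ x) ^ 2) with h' | h'
      · exact caseA (by rw [hf, if_neg h, min_eq_left h', mul_one])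
      · have hfx : f x = P * ((g x)⁻¹ ^ 2 * (Φ x) ^ 2) := by
          rw [hf, if_neg h, min_eq_right h']
        have h3 : P * (g x)⁻¹ ^ 2 ≤ f x / (F x) ^ 2 := by
          rw [le_div_iff₀ (by positivity), hfx, mul_assoc]
          gcongr
        have h4 : 2 * lam - lam ^ 2 * (g x) ^ 2 ≤ (g x)⁻¹ ^ 2 := by
          have h5 : (g x)⁻¹ * g x = 1 := inv_mul_cancel₀ h
          nlinarith [sq_nonneg ((g x)⁻¹ - lam * g x)]
        have h6 : 0 ≤ 2 * lam * f x := mul_nonneg (by positivity) (hf0 x)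
        have h7 := mul_le_mul_of_nonneg_left h4 hP.le
        linarith
  have hint : P * (2 * lam * T - lam ^ 2 * G) ≤
      (∫ x in (0:ℝ)..T, deriv u x) + 2 * lam * I := by
    have hL : IntervalIntegrable (fun x => P * (2 * lam - lam ^ 2 * (g x) ^ 2)) volume 0 T :=
      (intervalIntegrable_const.sub (hg_L2.const_mul _)).const_mul _
    have h1 := intervalIntegral.integral_mono_ae_restrict hT.le hL
      (huint.add (hfint.const_mul (2 * lam)))
      ((ae_restrict_iff' measurableSet_Icc).2 key)
    rw [intervalIntegral.integral_const_mul,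
      intervalIntegral.integral_sub intervalIntegrable_const (hg_L2.const_mul _),
      intervalIntegral.integral_const_mul, intervalIntegral.integral_const,
      intervalIntegral.integral_add huint (hfint.const_mul _),
      intervalIntegral.integral_const_mul, intervalIntegral.integral_const_mul,
      ← hG, ← hI] at h1
    simp only [sub_zero, smul_eq_mul] at h1
    linarith
  have e1 : P * (lam * T) = (Φ T)⁻¹ := by rw [hlam]; field_simp
  have e2 : P * (lam ^ 2 * G) ≤ (Φ T)⁻¹ / 8 := by
    have h1 : 8 * G ≤ Φ T * (P * T ^ 2) := by
      rw [div_mul_eq_mul_div, div_lt_iff₀ (by positivity)] at hcon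
      exact hcon.le
    have h2 := mul_le_mul_of_nonneg_left h1 (by positivity : 0 ≤ P * lam ^ 2)
    have h3 : P * lam ^ 2 * (Φ T * (P * T ^ 2)) = (Φ T)⁻¹ := by
      rw [hlam]; field_simp
    linarith
  have e3 : 2 * lam * I ≤ (Φ T)⁻¹ / 4 := by
    have := mul_le_mul_of_nonneg_left hIle (by positivity : 0 ≤ 2 * lam)
    linarith
  have : 0 < (Φ T)⁻¹ := inv_pos.2 hΦT
  linarith
end

section
/- Let P, T ∈ (0,∞). Let g : [0,T] → [0,∞) be measurable with ∫₀ᵀ g(t)² dt < ∞, and let Φ : [0,T] → ℝ be monotone decreasing. Define f : [0,T] → ℝ by f(t) = P·min{1, g(t)⁻²·Φ(t)²} when g(t) > 0 and f(t) = P when g(t) = 0, and assume that Φ(t₂) − Φ(t₁) ≤ −∫_{t₁}^{t₂} f(t) dt for all 0 ≤ t₁ < t₂ ≤ T. If Φ(T) ≥ −PT/8, then Φ(0) ≥ −(8/(P·T²))·∫₀ᵀ g(t)² dt. -/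
open MeasureTheory Set

/-- Part (2) of the ODE Lemma (Lemma 4.3). -/
theorem ode_lemma_part2 (P T : ℝ) (hP : 0 < P) (hT : 0 < T)
    (g Φ f : ℝ → ℝ)
    (hg_meas : Measurable g)
    (hg_nonneg : ∀ t ∈ Icc (0:ℝ) T, 0 ≤ g t)
    (hg_L2 : IntervalIntegrable (fun t => (g t) ^ 2) volume 0 T)
    (hΦ_mono : AntitoneOn Φ (Icc (0:ℝ) T))
    (hf : ∀ t, f t = if g t = 0 then P else P * min 1 ((g t)⁻¹ ^ 2 * (Φ t) ^ 2))
    (hΦ_ineq : ∀ t₁ t₂, 0 ≤ t₁ → t₁ < t₂ → t₂ ≤ T →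
      Φ t₂ - Φ t₁ ≤ - ∫ t in t₁..t₂, f t)
    (hΦT : Φ T ≥ -(P * T / 8)) :
    Φ 0 ≥ -((8 / (P * T ^ 2)) * ∫ t in (0:ℝ)..T, (g t) ^ 2) := by
  by_contra hcon
  have hcon : Φ 0 < -((8 / (P * T ^ 2)) * ∫ t in (0:ℝ)..T, (g t) ^ 2) := not_le.mp hcon
  set G := ∫ t in (0:ℝ)..T, (g t) ^ 2 with hG
  have hG0 : 0 ≤ G := intervalIntegral.integral_nonneg hT.le (fun t _ => sq_nonneg _)
  obtain ⟨a, ha⟩ : ∃ a, a = -Φ 0 := ⟨_, rfl⟩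
  have hPT : 0 < P * T ^ 2 := by positivity
  have haG' : (8 / (P * T ^ 2)) * G < a := by linarith
  have ha0 : 0 < a := lt_of_le_of_lt (by positivity) haG'
  have haG : 8 * G < a * (P * T ^ 2) := by
    rw [div_mul_eq_mul_div, div_lt_iff₀ hPT] at haG'
    exact haG'
  have hf0 : ∀ t, 0 ≤ f t := by
    intro t
    rw [hf]
    split_ifs
    · exact hP.le
    · positivity
  have hfP : ∀ t, f t ≤ P := by
    intro t
    rw [hf]
    split_ifs
    · exact le_rfl
    · have := min_le_left 1 ((g t)⁻¹ ^ 2 * (Φ t) ^ 2)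
      nlinarith
  have hfm : AEMeasurable f (volume.restrict (Icc 0 T)) := by
    have hΦm : AEMeasurable Φ (volume.restrict (Icc 0 T)) :=
      aemeasurable_restrict_of_antitoneOn measurableSet_Icc hΦ_mono
    have hs : MeasurableSet {t | g t = 0} := hg_meas (measurableSet_singleton 0)
    obtain ⟨Ψ, hΨ, hΦΨ⟩ := hΦm
    refine ⟨fun t => if g t = 0 then P else P * min 1 ((g t)⁻¹ ^ 2 * (Ψ t) ^ 2), ?_, ?_⟩
    · exact Measurable.ite hs measurable_const
        ((measurable_const.min ((hg_meas.inv.pow_const 2).mul (hΨ.pow_const 2))).const_mul P)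
    · filter_upwards [hΦΨ] with t ht
      rw [hf, ht]
  have hfi : IntervalIntegrable f volume 0 T := by
    rw [intervalIntegrable_iff_integrableOn_Icc_of_le hT.le]
    refine Integrable.of_bound hfm.aestronglyMeasurable P ?_
    refine Filter.Eventually.of_forall fun t => ?_
    rw [Real.norm_eq_abs, abs_of_nonneg (hf0 t)]
    exact hfP t
  have hsub : ∀ x ∈ Icc 0 T, ∀ y ∈ Icc 0 T, IntervalIntegrable f volume x y := by
    intro x hx y hy
    refine hfi.mono_set ?_
    rw [uIcc_of_le hT.le]
    exact uIcc_subset_Icc hx hy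
  have h0m : (0:ℝ) ∈ Icc 0 T := ⟨le_rfl, hT.le⟩
  have hTm : T ∈ Icc 0 T := ⟨hT.le, le_rfl⟩
  let v : ℝ → ℝ := fun t => a + ∫ s in (0:ℝ)..t, f s
  have hv0 : v 0 = a := by simp [v]
  have hvmono : MonotoneOn v (Icc 0 T) := by
    intro x hx y hy hxy
    have h1 := intervalIntegral.integral_add_adjacent_intervals (hsub 0 h0m x hx) (hsub x hx y hy)
    have h2 : 0 ≤ ∫ s in x..y, f s := intervalIntegral.integral_nonneg hxy (fun t _ => hf0 t)
    simp only [v]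
    linarith
  have hva : ∀ t ∈ Icc 0 T, a ≤ v t := fun t ht => hv0 ▸ hvmono h0m ht ht.1
  have hvu : ∀ t ∈ Icc 0 T, v t ≤ -Φ t := by
    intro t ht
    rcases ht.1.eq_or_lt with h | h
    · rw [← h, hv0, ha]
    · have := hΦ_ineq 0 t le_rfl h ht.2
      simp only [v]
      linarith
  let w : ℝ → ℝ := fun t => -(v t)⁻¹
  have hwmono : MonotoneOn w (Icc 0 T) := by
    intro x hx y hy hxy
    have := hvmono hx hy hxy
    have h1 := hva x hx
    exact neg_le_neg (inv_anti₀ (by linarith) this)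
  have hwmono' : MonotoneOn w (uIcc 0 T) := by rwa [uIcc_of_le hT.le]
  have hwint := hwmono'.intervalIntegrable_deriv
  have hwle : ∫ x in (0:ℝ)..T, deriv w x ≤ 1 / a := by
    have h1 := hwmono'.intervalIntegral_deriv_mem_uIcc
    rw [uIcc_of_le (sub_nonneg.2 (hwmono h0m hTm hT.le))] at h1
    have h2 : 0 < (v T)⁻¹ := inv_pos.2 (by linarith [hva T hTm])
    have h3 := h1.2
    simp only [w] at h3 ⊢
    rw [hv0] at h3
    rw [one_div]
    linarith
  have hwd : ∀ᵐ x, x ∈ Icc 0 T → deriv w x = f x * ((v x) ^ 2)⁻¹ := by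
    filter_upwards [hfi.ae_hasDerivAt_integral] with x hx hxm
    rw [uIcc_of_le hT.le] at hx
    have h1 : HasDerivAt v (f x) x := (hx hxm 0 h0m).const_add a
    have hne : v x ≠ 0 := (lt_of_lt_of_le ha0 (hva x hxm)).ne'
    have h2 := (h1.inv hne).neg
    have h3 : deriv w x = -(-f x / v x ^ 2) := h2.deriv
    rw [h3]
    ring
  obtain ⟨l, hl⟩ : ∃ l, l = 1 / (a * P * T) := ⟨_, rfl⟩
  have hl0 : 0 < l := by rw [hl]; positivity
  have hpt : ∀ x ∈ Icc 0 T,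
      P * (2 * l - l ^ 2 * (g x) ^ 2) ≤ f x * ((v x) ^ 2)⁻¹ + 2 * l * f x := by
    intro x hx
    have hv1 := hva x hx
    have hvp : 0 < v x := by linarith
    have hu := hvu x hx
    have hq : 0 ≤ f x * ((v x) ^ 2)⁻¹ := mul_nonneg (hf0 x) (by positivity)
    have hA : f x = P → P * (2 * l - l ^ 2 * (g x) ^ 2) ≤
        f x * ((v x) ^ 2)⁻¹ + 2 * l * f x := by
      intro h
      have : 0 ≤ P * (l ^ 2 * (g x) ^ 2) := by positivity
      rw [h] at hq ⊢
      nlinarith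
    by_cases hg0 : g x = 0
    · exact hA (by rw [hf, if_pos hg0])
    by_cases hm : 1 ≤ (g x)⁻¹ ^ 2 * (Φ x) ^ 2
    · exact hA (by rw [hf, if_neg hg0, min_eq_left hm, mul_one])
    have hfx : f x = P * ((g x)⁻¹ ^ 2 * (Φ x) ^ 2) := by
      rw [hf, if_neg hg0, min_eq_right (not_le.1 hm).le]
    have hsq : (v x) ^ 2 ≤ (Φ x) ^ 2 := by nlinarith
    have h1 : P * (g x)⁻¹ ^ 2 ≤ f x * ((v x) ^ 2)⁻¹ := by
      rw [← div_eq_mul_inv, le_div_iff₀ (by positivity), hfx, ← mul_assoc]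
      exact mul_le_mul_of_nonneg_left hsq (by positivity)
    have h2 : 0 ≤ 2 * l * f x := mul_nonneg (by positivity) (hf0 x)
    have h3 : (g x)⁻¹ * g x = 1 := inv_mul_cancel₀ hg0
    have h4 : 2 * l - l ^ 2 * (g x) ^ 2 ≤ (g x)⁻¹ ^ 2 := by
      have h5 := sq_nonneg ((g x)⁻¹ - l * g x)
      have h6 : ((g x)⁻¹ - l * g x) ^ 2 =
        (g x)⁻¹ ^ 2 - 2 * l * ((g x)⁻¹ * g x) + l ^ 2 * (g x) ^ 2 := by ring
      rw [h6, h3] at h5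
      linarith
    have h7 := mul_le_mul_of_nonneg_left h4 hP.le
    linarith
  have hI1 : IntervalIntegrable (fun x => P * (2 * l - l ^ 2 * (g x) ^ 2)) volume 0 T :=
    (intervalIntegrable_const.sub (hg_L2.const_mul _)).const_mul P
  have hI2 : IntervalIntegrable (fun x => 2 * l * f x) volume 0 T := hfi.const_mul _
  have hmain : ∫ x in (0:ℝ)..T, P * (2 * l - l ^ 2 * (g x) ^ 2) ≤
      ∫ x in (0:ℝ)..T, (deriv w x + 2 * l * f x) := by
    refine intervalIntegral.integral_mono_ae_restrict hT.le hI1 (hwint.add hI2) ?_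
    refine (ae_restrict_iff' measurableSet_Icc).2 ?_
    filter_upwards [hwd] with x hx hxm
    rw [hx hxm]
    exact hpt x hxm
  rw [intervalIntegral.integral_add hwint hI2, intervalIntegral.integral_const_mul,
    intervalIntegral.integral_const_mul,
    intervalIntegral.integral_sub intervalIntegrable_const (hg_L2.const_mul _),
    intervalIntegral.integral_const, intervalIntegral.integral_const_mul (l ^ 2), ← hG] at hmain
  simp only [smul_eq_mul, sub_zero] at hmain
  have hfint : ∫ t in (0:ℝ)..T, f t ≤ P * T / 8 := by
    have := hΦ_ineq 0 T le_rfl hT le_rfl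
    linarith
  have hk : 2 * l * ∫ t in (0:ℝ)..T, f t ≤ 2 * l * (P * T / 8) :=
    mul_le_mul_of_nonneg_left hfint (by positivity)
  have e1 : l * (P * T) = 1 / a := by
    rw [hl]
    field_simp
  have e2 : P * l ^ 2 * (8 * G) ≤ P * l ^ 2 * (a * (P * T ^ 2)) :=
    mul_le_mul_of_nonneg_left haG.le (by positivity)
  have e3 : P * l ^ 2 * (a * (P * T ^ 2)) = 1 / a := by
    rw [hl]
    field_simp
  have e4 : 0 < 1 / a := by positivity
  nlinarith
end

section
/- Fix y ∈ ℝ² and s ∈ ℝ, and let ρ(x,t) = (4π(s−t))^{−1/2}·exp(−|x−y|²/(4(s−t))) for x ∈ ℝ² and t < s. Then for every unit vector e ∈ ℝ², every x ∈ ℝ², and every t < s: ∂ρ/∂t(x,t) + D²ρ(x,t)[e,e] + (|∇ρ(x,t)|² − ⟨∇ρ(x,t), e⟩²)/ρ(x,t) = 0, where ∇ρ and D²ρ denote the gradient and the Hessian of ρ in the spatial variable x. -/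
open scoped RealInnerProductSpace

/-- Identity (5.10): the key pointwise identity behind Huisken's monotonicity formula
for 1-dimensional flows in ℝ²: for the backwards heat kernel `ρ` with pole at `(y,s)`
and any unit vector `e`, one has `∂ρ/∂t + Hess ρ (e,e) + (|∇ρ|² − ⟨∇ρ,e⟩²)/ρ = 0`. -/
theorem backwards_heat_kernel_identity
    (y : EuclideanSpace ℝ (Fin 2)) (s : ℝ)
    (ρ : EuclideanSpace ℝ (Fin 2) → ℝ → ℝ)
    (hρ : ∀ x t, ρ x t =
      (1 / Real.sqrt (4 * Real.pi * (s - t))) * Real.exp (-‖x - y‖ ^ 2 / (4 * (s - t))))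
    (e : EuclideanSpace ℝ (Fin 2)) (he : ‖e‖ = 1)
    (x : EuclideanSpace ℝ (Fin 2)) (t : ℝ) (ht : t < s) :
    deriv (fun τ => ρ x τ) t
      + iteratedFDeriv ℝ 2 (fun z => ρ z t) x ![e, e]
      + (‖gradient (fun z => ρ z t) x‖ ^ 2 - ⟪gradient (fun z => ρ z t) x, e⟫ ^ 2) / ρ x t
      = 0 := by
  have hu : 0 < s - t := sub_pos.mpr ht
  have h1 : ∀ z, HasFDerivAt (fun z => ρ z t)
      ((ρ z t * (-(1 / (2 * (s - t))))) • innerSL ℝ (z - y)) z := by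
    intro z
    have hsub : HasFDerivAt (fun z : EuclideanSpace ℝ (Fin 2) => z - y)
        (ContinuousLinearMap.id ℝ _) z := (hasFDerivAt_id z).sub_const y
    have h := (((hsub.norm_sq).neg.mul_const (1 / (4 * (s - t)))).exp).const_mul
      (1 / Real.sqrt (4 * Real.pi * (s - t)))
    have hf : (fun z => ρ z t) = fun z => (1 / Real.sqrt (4 * Real.pi * (s - t))) *
        Real.exp (-‖z - y‖ ^ 2 * (1 / (4 * (s - t)))) := by
      funext z
      rw [hρ, mul_one_div]
    rw [hf]
    refine h.congr_fderiv ?_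
    ext v
    rw [hρ, ← mul_one_div (-‖z - y‖ ^ 2)]
    simp
    field_simp
    ring
  have hfd : fderiv ℝ (fun z => ρ z t) =
      fun z => (ρ z t * (-(1 / (2 * (s - t))))) • innerSL ℝ (z - y) :=
    funext fun z => (h1 z).fderiv
  have h2 : iteratedFDeriv ℝ 2 (fun z => ρ z t) x ![e, e] =
      ρ x t * (⟪x - y, e⟫ ^ 2 / (4 * (s - t) ^ 2) - 1 / (2 * (s - t))) := by
    rw [iteratedFDeriv_two_apply, hfd]
    have hsub : HasFDerivAt (fun z : EuclideanSpace ℝ (Fin 2) => z - y)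
        (ContinuousLinearMap.id ℝ _) x := (hasFDerivAt_id x).sub_const y
    have hin := (innerSL ℝ (E := EuclideanSpace ℝ (Fin 2))).hasFDerivAt.comp x hsub
    have h := ((h1 x).mul_const (-(1 / (2 * (s - t))))).smul hin
    have h' : fderiv ℝ (fun z => (ρ z t * (-(1 / (2 * (s - t))))) • innerSL ℝ (z - y)) x = _ :=
      h.fderiv
    rw [h']
    have hee : ⟪e, e⟫ = (1 : ℝ) := by rw [real_inner_self_eq_norm_sq, he]; norm_num
    change (ρ x t * -(1 / (2 * (s - t)))) * ⟪e, e⟫ +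
      (-(1 / (2 * (s - t))) * ((ρ x t * -(1 / (2 * (s - t)))) * ⟪x - y, e⟫)) * ⟪x - y, e⟫ = _
    rw [hee]
    field_simp
    ring
  have hg : gradient (fun z => ρ z t) x = (ρ x t * (-(1 / (2 * (s - t))))) • (x - y) := by
    apply HasGradientAt.gradient
    rw [hasGradientAt_iff_hasFDerivAt]
    refine (h1 x).congr_fderiv ?_
    ext v
    simp
  have h3 : deriv (fun τ => ρ x τ) t =
      ρ x t * (1 / (2 * (s - t)) - ‖x - y‖ ^ 2 / (4 * (s - t) ^ 2)) := by
    have hpos : 0 < 4 * Real.pi * (s - t) := by positivity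
    have hs : HasDerivAt (fun τ => s - τ) (-1) t := by
      simpa using (hasDerivAt_id t).const_sub s
    have ha := ((hs.const_mul (4 * Real.pi)).sqrt hpos.ne').inv (Real.sqrt_pos.mpr hpos).ne'
    have hb := ((hasDerivAt_const t (-‖x - y‖ ^ 2)).div (hs.const_mul 4) (by positivity)).exp
    have h := ha.mul hb
    have hf : (fun τ => ρ x τ) = fun τ => (Real.sqrt (4 * Real.pi * (s - τ)))⁻¹ *
        Real.exp (-‖x - y‖ ^ 2 / (4 * (s - τ))) := by
      funext τ
      rw [hρ, one_div]
    rw [hf, hρ]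
    refine (HasDerivAt.deriv h).trans ?_
    have hsq : Real.sqrt (4 * Real.pi * (s - t)) ^ 2 = 4 * Real.pi * (s - t) :=
      Real.sq_sqrt hpos.le
    have hq := Real.sqrt_pos.mpr hpos
    simp only [Pi.div_apply, Pi.inv_apply]
    rw [hsq]
    generalize Real.sqrt (4 * Real.pi * (s - t)) = q at *
    have hpi := Real.pi_pos
    field_simp
    ring
  have hρpos : 0 < ρ x t := by rw [hρ]; positivity
  rw [h2, hg, h3, norm_smul, real_inner_smul_left, mul_pow, Real.norm_eq_abs, sq_abs]
  field_simp
  ring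
end

section
/- Let I ⊆ ℝ be an open interval, and for j = 1,2,3 let γ_j : [0,1] × I → ℝ² be smooth maps with ∂_uγ_j(u,t) ≠ 0 for all (u,t), such that γ₁(0,t) = γ₂(0,t) = γ₃(0,t) for every t ∈ I, and such that the unit tangent vectors T_j(t) = ∂_uγ_j(0,t)/|∂_uγ_j(0,t)| satisfy T₁(t) + T₂(t) + T₃(t) = 0 for every t ∈ I (the 120-degree Herring condition at the junction). Let φ : ℝ² × I → ℝ be C¹ with φ(γ_j(1,t), t) = 0 for all t ∈ I and j = 1,2,3. Then for every t ∈ I: d/dt Σ_{j=1}^{3} ∫₀¹ φ(γ_j(u,t),t)·|∂_uγ_j(u,t)| du = Σ_{j=1}^{3} ∫₀¹ [ ∂_tφ(γ_j(u,t),t) + (∇φ(γ_j(u,t),t) − φ(γ_j(u,t),t)·h_j(u,t)) · v_j(u,t) ]·|∂_uγ_j(u,t)| du, where T̂_j = ∂_uγ_j/|∂_uγ_j|, h_j = |∂_uγ_j|⁻¹·∂_uT̂_j is the curvature vector, and v_j = ∂_tγ_j − ⟨∂_tγ_j, T̂_j⟩·T̂_j is the normal velocity. -/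
open scoped RealInnerProductSpace

/-- Spatial (parameter) derivative `∂_uγ` of a moving curve `γ`. -/
noncomputable def du (γ : ℝ → ℝ → EuclideanSpace ℝ (Fin 2)) (u t : ℝ) :
    EuclideanSpace ℝ (Fin 2) :=
  deriv (fun u' => γ u' t) u

/-- Time derivative `∂_tγ` of a moving curve `γ`. -/
noncomputable def dtγ (γ : ℝ → ℝ → EuclideanSpace ℝ (Fin 2)) (u t : ℝ) :
    EuclideanSpace ℝ (Fin 2) :=
  deriv (fun t' => γ u t') t

/-- Unit tangent vector `T̂ = ∂_uγ/|∂_uγ|`. -/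
noncomputable def tang (γ : ℝ → ℝ → EuclideanSpace ℝ (Fin 2)) (u t : ℝ) :
    EuclideanSpace ℝ (Fin 2) :=
  ‖du γ u t‖⁻¹ • du γ u t

/-- Curvature vector `h = |∂_uγ|⁻¹ ∂_u T̂`. -/
noncomputable def curv (γ : ℝ → ℝ → EuclideanSpace ℝ (Fin 2)) (u t : ℝ) :
    EuclideanSpace ℝ (Fin 2) :=
  ‖du γ u t‖⁻¹ • deriv (fun u' => tang γ u' t) u

/-- Normal velocity `v = ∂_tγ − ⟨∂_tγ, T̂⟩ T̂`. -/
noncomputable def nvel (γ : ℝ → ℝ → EuclideanSpace ℝ (Fin 2)) (u t : ℝ) :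
    EuclideanSpace ℝ (Fin 2) :=
  dtγ γ u t - ⟪dtγ γ u t, tang γ u t⟫ • tang γ u t

abbrev E2 := EuclideanSpace ℝ (Fin 2)

lemma hasDerivAt_norm_aux {f : ℝ → E2} {f' : E2} {x : ℝ}
    (hf : HasDerivAt f f' x) (h0 : f x ≠ 0) :
    HasDerivAt (fun y => ‖f y‖) (‖f x‖⁻¹ * ⟪f x, f'⟫) x := by
  have h1 := (hf.norm_sq).sqrt (by positivity)
  have hn : ‖f x‖ ≠ 0 := norm_ne_zero_iff.2 h0
  have e : (fun y => √(‖f y‖ ^ 2)) = fun y => ‖f y‖ := by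
    funext y; exact Real.sqrt_sq (norm_nonneg _)
  rw [e, Real.sqrt_sq (norm_nonneg _)] at h1
  convert h1 using 1
  field_simp

lemma hasDerivAt_unit_aux {f : ℝ → E2} {f' : E2} {x : ℝ}
    (hf : HasDerivAt f f' x) (h0 : f x ≠ 0) :
    HasDerivAt (fun y => ‖f y‖⁻¹ • f y)
      (‖f x‖⁻¹ • f' - (‖f x‖⁻¹ * ⟪f x, f'⟫ / ‖f x‖ ^ 2) • f x) x := by
  have hn : ‖f x‖ ≠ 0 := norm_ne_zero_iff.2 h0
  have h1 := ((hasDerivAt_norm_aux hf h0).fun_inv hn).fun_smul hf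
  rw [neg_div, neg_smul, ← sub_eq_add_neg] at h1
  exact h1

section curve

variable {γ : ℝ → ℝ → E2}

/-- directional derivative -/
noncomputable def Dd (γ : ℝ → ℝ → E2) (e : ℝ × ℝ) (u t : ℝ) : E2 :=
  fderiv ℝ (fun p : ℝ × ℝ => γ p.1 p.2) (u, t) e

lemma Dd_contDiff (hγ : ContDiff ℝ (⊤ : ℕ∞) (fun p : ℝ × ℝ => γ p.1 p.2)) (e : ℝ × ℝ) :
    ContDiff ℝ (⊤ : ℕ∞) (fun p : ℝ × ℝ => Dd γ e p.1 p.2) := by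
  have : ContDiff ℝ (⊤ : ℕ∞) (fderiv ℝ (fun p : ℝ × ℝ => γ p.1 p.2)) :=
    hγ.fderiv_right (by simp)
  exact this.clm_apply contDiff_const

lemma Dd_hasDerivAt_u (hγ : ContDiff ℝ (⊤ : ℕ∞) (fun p : ℝ × ℝ => γ p.1 p.2)) (u t : ℝ) :
    HasDerivAt (fun u' => γ u' t) (Dd γ (1, 0) u t) u := by
  have h := (hγ.differentiable (by simp) (u, t)).hasFDerivAt
  have h2 : HasDerivAt (fun u' : ℝ => (u', t)) ((1 : ℝ), (0 : ℝ)) u :=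
    (hasDerivAt_id u).prodMk (hasDerivAt_const u t)
  exact HasFDerivAt.comp_hasDerivAt (f := fun u' : ℝ => (u', t)) u h h2

lemma Dd_hasDerivAt_t (hγ : ContDiff ℝ (⊤ : ℕ∞) (fun p : ℝ × ℝ => γ p.1 p.2)) (u t : ℝ) :
    HasDerivAt (fun t' => γ u t') (Dd γ (0, 1) u t) t := by
  have h := (hγ.differentiable (by simp) (u, t)).hasFDerivAt
  have h2 : HasDerivAt (fun t' : ℝ => (u, t')) ((0 : ℝ), (1 : ℝ)) t :=
    (hasDerivAt_const t u).prodMk (hasDerivAt_id t)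
  exact HasFDerivAt.comp_hasDerivAt (f := fun t' : ℝ => (u, t')) t h h2

lemma Dd_symm (hγ : ContDiff ℝ (⊤ : ℕ∞) (fun p : ℝ × ℝ => γ p.1 p.2)) (u t : ℝ) (a b : ℝ × ℝ) :
    Dd (Dd γ a) b u t = Dd (Dd γ b) a u t := by
  have hs : IsSymmSndFDerivAt ℝ (fun p : ℝ × ℝ => γ p.1 p.2) (u, t) :=
    hγ.contDiffAt.isSymmSndFDerivAt (by simp; exact WithTop.coe_le_coe.2 (le_top : (2 : ℕ∞) ≤ ⊤))
  have hd : DifferentiableAt ℝ (fderiv ℝ (fun p : ℝ × ℝ => γ p.1 p.2)) (u, t) :=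
    (hγ.fderiv_right (m := ((⊤ : ℕ∞) : WithTop ℕ∞)) (by simp)).differentiable (by simp) _
  have key : ∀ a b : ℝ × ℝ, Dd (Dd γ a) b u t
      = fderiv ℝ (fderiv ℝ (fun p : ℝ × ℝ => γ p.1 p.2)) (u, t) b a := by
    intro a b
    have := (hd.hasFDerivAt.clm_apply (hasFDerivAt_const a (u, t))).fderiv
    have h2 : Dd (Dd γ a) b u t = fderiv ℝ (fun p : ℝ × ℝ =>
      fderiv ℝ (fun p : ℝ × ℝ => γ p.1 p.2) p a) (u, t) b := rfl
    rw [h2, this]; simp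
  rw [key, key]
  exact hs _ _

lemma curve_variation (hγ : ContDiff ℝ (⊤ : ℕ∞) (fun p : ℝ × ℝ => γ p.1 p.2))
    (I : Set ℝ) (hI : IsOpen I)
    (hreg : ∀ u ∈ Set.Icc (0:ℝ) 1, ∀ t ∈ I, du γ u t ≠ 0)
    (φ : E2 → ℝ → ℝ)
    (hφ : ContDiff ℝ 1 (fun p : E2 × ℝ => φ p.1 p.2)) (t : ℝ) (ht : t ∈ I) :
    HasDerivAt (fun τ => ∫ u in (0:ℝ)..1, φ (γ u τ) τ * ‖du γ u τ‖)
      ((∫ u in (0:ℝ)..1,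
          (deriv (fun τ => φ (γ u t) τ) t
            + ⟪gradient (fun z => φ z t) (γ u t) - φ (γ u t) t • curv γ u t,
                nvel γ u t⟫) * ‖du γ u t‖)
        + (φ (γ 1 t) t * ⟪dtγ γ 1 t, tang γ 1 t⟫ - φ (γ 0 t) t * ⟪dtγ γ 0 t, tang γ 0 t⟫)) t := by
  have edu : du γ = Dd γ (1, 0) := by
    funext u t; exact (Dd_hasDerivAt_u hγ u t).deriv
  have edt : dtγ γ = Dd γ (0, 1) := by
    funext u t; exact (Dd_hasDerivAt_t hγ u t).deriv
  set A := Dd γ (1, 0) with hA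
  set B := Dd γ (0, 1) with hB
  have hAs : ContDiff ℝ (⊤ : ℕ∞) (fun p : ℝ × ℝ => A p.1 p.2) := Dd_contDiff hγ _
  have hBs : ContDiff ℝ (⊤ : ℕ∞) (fun p : ℝ × ℝ => B p.1 p.2) := Dd_contDiff hγ _
  set M := Dd A (0, 1) with hM
  set L := Dd A (1, 0) with hL
  have hMc : Continuous (fun p : ℝ × ℝ => M p.1 p.2) := (Dd_contDiff hAs _).continuous
  have hLc : Continuous (fun p : ℝ × ℝ => L p.1 p.2) := (Dd_contDiff hAs _).continuous
  have hAc := hAs.continuous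
  have hBc := hBs.continuous
  have hγc := hγ.continuous
  have hAt : ∀ u t, HasDerivAt (fun t' => A u t') (M u t) t := Dd_hasDerivAt_t hAs
  have hAu : ∀ u t, HasDerivAt (fun u' => A u' t) (L u t) u := Dd_hasDerivAt_u hAs
  have hBu : ∀ u t, HasDerivAt (fun u' => B u' t) (M u t) u := by
    intro u t
    rw [hM, hA, Dd_symm hγ]
    exact Dd_hasDerivAt_u hBs u t
  rw [edu] at hreg
  -- derivative of φ
  set P : E2 × ℝ → (E2 × ℝ →L[ℝ] ℝ) := fderiv ℝ (fun p : E2 × ℝ => φ p.1 p.2) with hP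
  have hPc : Continuous P := hφ.continuous_fderiv (by simp)
  have hφc : Continuous (fun p : E2 × ℝ => φ p.1 p.2) := hφ.continuous
  have hPd : ∀ q, HasFDerivAt (fun p : E2 × ℝ => φ p.1 p.2) (P q) q := fun q =>
    (hφ.differentiable (by simp) q).hasFDerivAt
  have hφt : ∀ u t, HasDerivAt (fun τ => φ (γ u τ) τ) (P (γ u t, t) (B u t, 1)) t := by
    intro u t
    have h2 : HasDerivAt (fun τ : ℝ => (γ u τ, τ)) (B u t, (1 : ℝ)) t :=
      (Dd_hasDerivAt_t hγ u t).prodMk (hasDerivAt_id t)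
    exact HasFDerivAt.comp_hasDerivAt (f := fun τ : ℝ => (γ u τ, τ)) t (hPd _) h2
  have hφu : ∀ u t, HasDerivAt (fun u' => φ (γ u' t) t) (P (γ u t, t) (A u t, 0)) u := by
    intro u t
    have h2 : HasDerivAt (fun u' : ℝ => (γ u' t, t)) (A u t, (0 : ℝ)) u :=
      (Dd_hasDerivAt_u hγ u t).prodMk (hasDerivAt_const u t)
    exact HasFDerivAt.comp_hasDerivAt (f := fun u' : ℝ => (γ u' t, t)) u (hPd _) h2
  have hφτ : ∀ x t, deriv (fun τ => φ x τ) t = P (x, t) (0, 1) := by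
    intro x t
    have h2 : HasDerivAt (fun τ : ℝ => (x, τ)) ((0 : E2), (1 : ℝ)) t :=
      (hasDerivAt_const t x).prodMk (hasDerivAt_id t)
    exact (HasFDerivAt.comp_hasDerivAt (f := fun τ : ℝ => (x, τ)) t (hPd _) h2).deriv
  have hgrad : ∀ x t v, ⟪gradient (fun z => φ z t) x, v⟫ = P (x, t) (v, 0) := by
    intro x t v
    have h2 : HasFDerivAt (fun z : E2 => (z, t)) (ContinuousLinearMap.inl ℝ E2 ℝ) x :=
      hasFDerivAt_prodMk_left x t
    have h3 : HasFDerivAt (fun z => φ z t) ((P (x, t)).comp (ContinuousLinearMap.inl ℝ E2 ℝ)) x :=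
      HasFDerivAt.comp (f := fun z : E2 => (z, t)) x (hPd _) h2
    rw [gradient, InnerProductSpace.toDual_symm_apply, h3.fderiv]
    simp
  -- time derivative
  let F' : ℝ → ℝ → ℝ := fun τ u => P (γ u τ, τ) (B u τ, 1) * ‖A u τ‖
    + φ (γ u τ) τ * (‖A u τ‖⁻¹ * ⟪A u τ, M u τ⟫)
  have hF'c : ContinuousOn (fun p : ℝ × ℝ => F' p.2 p.1) (Set.Icc 0 1 ×ˢ I) := by
    have h1 : Continuous (fun p : ℝ × ℝ => P (γ p.1 p.2, p.2) (B p.1 p.2, 1) * ‖A p.1 p.2‖) := by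
      have : Continuous (fun p : ℝ × ℝ => P (γ p.1 p.2, p.2)) := hPc.comp (hγc.prodMk continuous_snd)
      exact (this.clm_apply (hBc.prodMk continuous_const)).mul hAc.norm
    have h2 : Continuous (fun p : ℝ × ℝ => φ (γ p.1 p.2) p.2) :=
      hφc.comp (hγc.prodMk continuous_snd)
    have h3 : ContinuousOn (fun p : ℝ × ℝ => ‖A p.1 p.2‖⁻¹) (Set.Icc 0 1 ×ˢ I) :=
      hAc.norm.continuousOn.inv₀ (fun p hp => norm_ne_zero_iff.2 (hreg _ hp.1 _ hp.2))
    exact h1.continuousOn.add (h2.continuousOn.mul (h3.mul (hAc.inner hMc).continuousOn))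
  have hFc : Continuous (fun p : ℝ × ℝ => φ (γ p.1 p.2) p.2 * ‖A p.1 p.2‖) :=
    (hφc.comp (hγc.prodMk continuous_snd)).mul hAc.norm
  have hF'd : ∀ u ∈ Set.Icc (0:ℝ) 1, ∀ τ ∈ I,
      HasDerivAt (fun τ => φ (γ u τ) τ * ‖A u τ‖) (F' τ u) τ := by
    intro u hu τ hτ
    exact (hφt u τ).mul (hasDerivAt_norm_aux (hAt u τ) (hreg u hu τ hτ))
  obtain ⟨ε, hε, hball⟩ := Metric.nhds_basis_closedBall.mem_iff.1 (hI.mem_nhds ht)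
  obtain ⟨C, hC⟩ := ((isCompact_Icc (a := (0:ℝ)) (b := 1)).prod
    (isCompact_closedBall t ε)).exists_bound_of_continuousOn
      (hF'c.mono (Set.prod_mono subset_rfl hball))
  have hsub : Set.uIoc (0:ℝ) 1 ⊆ Set.Icc 0 1 := by
    rw [Set.uIoc_of_le zero_le_one]; exact Set.Ioc_subset_Icc_self
  have hF'tc : ContinuousOn (F' t) (Set.Icc 0 1) := by
    have : ContinuousOn (fun u : ℝ => (u, t)) (Set.Icc 0 1) := by fun_prop
    exact hF'c.comp this (fun u hu => ⟨hu, ht⟩)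
  have hslice : ∀ τ : ℝ, Continuous (fun u : ℝ => φ (γ u τ) τ * ‖A u τ‖) := fun τ =>
    hFc.comp (continuous_id.prodMk continuous_const)
  have main : HasDerivAt (fun τ => ∫ u in (0:ℝ)..1, φ (γ u τ) τ * ‖A u τ‖)
      (∫ u in (0:ℝ)..1, F' t u) t := by
    refine (intervalIntegral.hasDerivAt_integral_of_dominated_loc_of_deriv_le
      (F := fun τ u => φ (γ u τ) τ * ‖A u τ‖) (F' := F') (bound := fun _ => C)
      (Metric.closedBall_mem_nhds t hε) ?_ ?_ ?_ ?_ ?_ ?_).2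
    · exact Filter.Eventually.of_forall fun τ => (hslice τ).aestronglyMeasurable
    · exact (hslice t).intervalIntegrable _ _
    · exact (hF'tc.mono hsub).aestronglyMeasurable measurableSet_uIoc
    · exact Filter.Eventually.of_forall fun u hu τ hτ => hC (u, τ) ⟨hsub hu, hτ⟩
    · exact intervalIntegrable_const
    · exact Filter.Eventually.of_forall fun u hu τ hτ => hF'd u (hsub hu) τ (hball hτ)
  -- integration by parts
  have etang : ∀ u, tang γ u t = ‖A u t‖⁻¹ • A u t := fun u => by rw [tang, edu]
  let T' : ℝ → E2 := fun u => ‖A u t‖⁻¹ • L u t - (‖A u t‖⁻¹ * ⟪A u t, L u t⟫ / ‖A u t‖ ^ 2) • A u t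
  have hT : ∀ u ∈ Set.Icc (0:ℝ) 1, HasDerivAt (fun u' => tang γ u' t) (T' u) u := by
    intro u hu
    simp only [etang]
    exact hasDerivAt_unit_aux (hAu u t) (hreg u hu t ht)
  let G' : ℝ → ℝ := fun u => P (γ u t, t) (A u t, 0) * ⟪B u t, tang γ u t⟫
    + φ (γ u t) t * (⟪B u t, T' u⟫ + ⟪M u t, tang γ u t⟫)
  have hG : ∀ u ∈ Set.Icc (0:ℝ) 1,
      HasDerivAt (fun u => φ (γ u t) t * ⟪B u t, tang γ u t⟫) (G' u) u := fun u hu =>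
    (hφu u t).mul ((hBu u t).inner ℝ (hT u hu))
  have sl : ∀ {X : Type} [TopologicalSpace X] {f : ℝ × ℝ → X}, Continuous f →
      ContinuousOn (fun u => f (u, t)) (Set.Icc 0 1) := fun hf =>
    (hf.comp (continuous_id.prodMk continuous_const)).continuousOn
  have hG'c : ContinuousOn G' (Set.Icc 0 1) := by
    have a1 := sl hAc
    have a2 := sl hBc
    have a3 := sl hMc
    have a4 := sl hLc
    have a5 : ContinuousOn (fun u => ‖A u t‖⁻¹) (Set.Icc 0 1) :=
      a1.norm.inv₀ (fun u hu => norm_ne_zero_iff.2 (hreg _ hu _ ht))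
    have a6 : ContinuousOn (fun u => tang γ u t) (Set.Icc 0 1) := fun u hu =>
      (hT u hu).continuousAt.continuousWithinAt
    have a7 : ContinuousOn T' (Set.Icc 0 1) :=
      (a5.smul a4).sub (((a5.mul (a1.inner a4)).div (a1.norm.pow 2) (fun u hu =>
        pow_ne_zero 2 (norm_ne_zero_iff.2 (hreg _ hu _ ht)))).smul a1)
    have a8 : ContinuousOn (fun u => φ (γ u t) t) (Set.Icc 0 1) :=
      sl (hφc.comp (hγc.prodMk continuous_snd))
    have a9 : ContinuousOn (fun u => P (γ u t, t)) (Set.Icc 0 1) :=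
      sl (hPc.comp (hγc.prodMk continuous_snd))
    exact ((a9.clm_apply (a1.prodMk continuousOn_const)).mul (a2.inner a6)).add
      (a8.mul ((a2.inner a7).add (a3.inner a6)))
  have hui : Set.uIcc (0:ℝ) 1 = Set.Icc 0 1 := Set.uIcc_of_le zero_le_one
  have iG : IntervalIntegrable G' MeasureTheory.volume 0 1 :=
    ContinuousOn.intervalIntegrable (by rwa [hui])
  have iF : IntervalIntegrable (F' t) MeasureTheory.volume 0 1 :=
    ContinuousOn.intervalIntegrable (by rwa [hui])
  have ftc := intervalIntegral.integral_eq_sub_of_hasDerivAt (fun u hu => hG u (hui ▸ hu)) iG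
  have hR : (∫ u in (0:ℝ)..1,
          (deriv (fun τ => φ (γ u t) τ) t
            + ⟪gradient (fun z => φ z t) (γ u t) - φ (γ u t) t • curv γ u t,
                nvel γ u t⟫) * ‖A u t‖) = ∫ u in (0:ℝ)..1, (F' t u - G' u) := by
    refine intervalIntegral.integral_congr (fun u hu => ?_)
    rw [hui] at hu
    have hn : ‖A u t‖ ≠ 0 := norm_ne_zero_iff.2 (hreg u hu t ht)
    have hAA : ⟪A u t, A u t⟫ = ‖A u t‖ ^ 2 := real_inner_self_eq_norm_sq _
    have ecurv : curv γ u t = ‖A u t‖⁻¹ • T' u := by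
      rw [curv, (hT u hu).deriv, edu]
    have hTA : ⟪T' u, A u t⟫ = 0 := by
      simp only [T', inner_sub_left, real_inner_smul_left, hAA, real_inner_comm (A u t) (L u t)]
      field_simp
      ring
    have hsplit : P (γ u t, t) (B u t, 1) = P (γ u t, t) (0, 1) + P (γ u t, t) (B u t, 0) := by
      rw [← map_add]; simp
    simp only [F', G', hφτ, inner_sub_left, hgrad, ecurv, nvel, edt, hsplit, etang]
    rw [← hgrad, ← hgrad, ← hgrad]
    simp only [inner_sub_right, real_inner_smul_left, real_inner_smul_right, hTA,
      real_inner_comm (T' u) (B u t), real_inner_comm (A u t) (M u t)]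
    field_simp
    ring
  rw [edu]
  rw [hR, intervalIntegral.integral_sub iF iG, ftc]
  simp only [edt]
  convert main using 1
  ring

end curve

/-- First variation of length formula (2.8) for a moving planar network of three curves
meeting at a common triple junction at 120-degree angles (Herring condition). -/
theorem first_variation_of_length_network
    (I : Set ℝ) (hI : IsOpen I) (hIconn : IsPreconnected I)
    (γ : Fin 3 → ℝ → ℝ → EuclideanSpace ℝ (Fin 2))
    (hγ : ∀ j, ContDiff ℝ (⊤ : ℕ∞) (fun p : ℝ × ℝ => γ j p.1 p.2))
    (hreg : ∀ j, ∀ u ∈ Set.Icc (0:ℝ) 1, ∀ t ∈ I, du (γ j) u t ≠ 0)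
    (hjunc : ∀ t ∈ I, γ 0 0 t = γ 1 0 t ∧ γ 1 0 t = γ 2 0 t)
    (hherring : ∀ t ∈ I, tang (γ 0) 0 t + tang (γ 1) 0 t + tang (γ 2) 0 t = 0)
    (φ : EuclideanSpace ℝ (Fin 2) → ℝ → ℝ)
    (hφ : ContDiff ℝ 1 (fun p : EuclideanSpace ℝ (Fin 2) × ℝ => φ p.1 p.2))
    (hφend : ∀ t ∈ I, ∀ j : Fin 3, φ (γ j 1 t) t = 0) :
    ∀ t ∈ I,
      HasDerivAt
        (fun τ => ∑ j : Fin 3, ∫ u in (0:ℝ)..1, φ (γ j u τ) τ * ‖du (γ j) u τ‖)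
        (∑ j : Fin 3, ∫ u in (0:ℝ)..1,
          (deriv (fun τ => φ (γ j u t) τ) t
            + ⟪gradient (fun z => φ z t) (γ j u t) - φ (γ j u t) t • curv (γ j) u t,
                nvel (γ j) u t⟫) * ‖du (γ j) u t‖) t := by
  intro t ht
  have hs : HasDerivAt
        (fun τ => ∑ j : Fin 3, ∫ u in (0:ℝ)..1, φ (γ j u τ) τ * ‖du (γ j) u τ‖) _ t :=
    HasDerivAt.fun_sum (u := Finset.univ) fun j _ =>
      curve_variation (hγ j) I hI (hreg j) φ hφ t ht
  convert hs using 1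
  rw [Finset.sum_add_distrib]
  have e1 : γ 1 0 t = γ 0 0 t := (hjunc t ht).1.symm
  have e2 : γ 2 0 t = γ 0 0 t := by rw [← (hjunc t ht).2, e1]
  have d1 : dtγ (γ 1) 0 t = dtγ (γ 0) 0 t := by
    apply Filter.EventuallyEq.deriv_eq
    filter_upwards [hI.mem_nhds ht] with s hs
    exact (hjunc s hs).1.symm
  have d2 : dtγ (γ 2) 0 t = dtγ (γ 0) 0 t := by
    apply Filter.EventuallyEq.deriv_eq
    filter_upwards [hI.mem_nhds ht] with s hs
    rw [(hjunc s hs).1, (hjunc s hs).2]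
  have hz : ⟪dtγ (γ 0) 0 t, tang (γ 0) 0 t⟫ + ⟪dtγ (γ 0) 0 t, tang (γ 1) 0 t⟫
      + ⟪dtγ (γ 0) 0 t, tang (γ 2) 0 t⟫ = 0 := by
    rw [← inner_add_right, ← inner_add_right, hherring t ht, inner_zero_right]
  have hb : ∑ j : Fin 3, (φ (γ j 1 t) t * ⟪dtγ (γ j) 1 t, tang (γ j) 1 t⟫
      - φ (γ j 0 t) t * ⟪dtγ (γ j) 0 t, tang (γ j) 0 t⟫) = 0 := by
    simp only [hφend t ht, zero_mul, zero_sub, Fin.sum_univ_three]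
    rw [e1, e2, d1, d2]
    linear_combination (-φ (γ 0 0 t) t) * hz
  rw [hb, add_zero]
end

section
/- Let κ ∈ (0,1) and C > 0, and let f : (0,1) × (5/4,5/2) → ℝ be a bounded smooth function satisfying the heat equation ∂f/∂t = ∂²f/∂x² on (0,1) × (5/4,5/2), such that ∫₀^τ f(x,t)² dx ≤ C·τ^{2κ+1} for every τ ∈ (0,1/4) and every t ∈ (5/4,5/2). Define the odd extension F on (−1,1) × (5/4,5/2) by F(x,t) = f(x,t) for x ∈ (0,1), F(0,t) = 0, and F(x,t) = −f(−x,t) for x ∈ (−1,0). Then: (i) F is a weak solution of the heat equation, i.e., ∫∫ F·(∂φ/∂t + ∂²φ/∂x²) dx dt = 0 for every smooth φ compactly supported in (−1,1) × (5/4,5/2); and (ii) F agrees almost everywhere with a C^∞ solution of the heat equation on (−1,1) × (5/4,5/2); in particular f extends continuously to x = 0 with boundary value f(0,t) = 0 for all t ∈ (5/4,5/2). -/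
open MeasureTheory Set Filter
open scoped Topology

/-- partial derivative in the first variable -/
noncomputable def hDx (u : ℝ × ℝ → ℝ) (z : ℝ × ℝ) : ℝ := deriv (fun y => u (y, z.2)) z.1
/-- partial derivative in the second variable -/
noncomputable def hDt (u : ℝ × ℝ → ℝ) (z : ℝ × ℝ) : ℝ := deriv (fun s => u (z.1, s)) z.2

lemma hDx_hasDerivAt {u : ℝ × ℝ → ℝ} {x t : ℝ} (h : DifferentiableAt ℝ u (x, t)) :
    HasDerivAt (fun y => u (y, t)) (fderiv ℝ u (x, t) (1, 0)) x := by
  have h1 : HasDerivAt (fun y : ℝ => (y, t)) ((1 : ℝ), (0 : ℝ)) x :=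
    (hasDerivAt_id x).prodMk (hasDerivAt_const x t)
  exact h.hasFDerivAt.comp_hasDerivAt x h1

lemma hDt_hasDerivAt {u : ℝ × ℝ → ℝ} {x t : ℝ} (h : DifferentiableAt ℝ u (x, t)) :
    HasDerivAt (fun s => u (x, s)) (fderiv ℝ u (x, t) (0, 1)) t := by
  have h1 : HasDerivAt (fun s : ℝ => (x, s)) ((0 : ℝ), (1 : ℝ)) t :=
    (hasDerivAt_const t x).prodMk (hasDerivAt_id t)
  exact h.hasFDerivAt.comp_hasDerivAt t h1

lemma hDx_eq {u : ℝ × ℝ → ℝ} {z : ℝ × ℝ} (h : DifferentiableAt ℝ u z) :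
    hDx u z = fderiv ℝ u z (1, 0) := (hDx_hasDerivAt (x := z.1) (t := z.2) h).deriv

lemma hDt_eq {u : ℝ × ℝ → ℝ} {z : ℝ × ℝ} (h : DifferentiableAt ℝ u z) :
    hDt u z = fderiv ℝ u z (0, 1) := (hDt_hasDerivAt (x := z.1) (t := z.2) h).deriv

lemma hDx_contDiffOn {u : ℝ × ℝ → ℝ} {U : Set (ℝ × ℝ)} (hU : IsOpen U)
    (h : ContDiffOn ℝ (⊤ : ℕ∞) u U) : ContDiffOn ℝ (⊤ : ℕ∞) (hDx u) U := by
  have h1 : ContDiffOn ℝ (⊤ : ℕ∞) (fun z => fderiv ℝ u z (1, 0)) U :=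
    (h.fderiv_of_isOpen hU (m := (⊤ : ℕ∞)) (by simp)).clm_apply contDiffOn_const
  refine h1.congr fun z hz => hDx_eq ?_
  exact (h.contDiffAt (hU.mem_nhds hz)).differentiableAt (by simp)

lemma hDt_contDiffOn {u : ℝ × ℝ → ℝ} {U : Set (ℝ × ℝ)} (hU : IsOpen U)
    (h : ContDiffOn ℝ (⊤ : ℕ∞) u U) : ContDiffOn ℝ (⊤ : ℕ∞) (hDt u) U := by
  have h1 : ContDiffOn ℝ (⊤ : ℕ∞) (fun z => fderiv ℝ u z (0, 1)) U :=
    (h.fderiv_of_isOpen hU (m := (⊤ : ℕ∞)) (by simp)).clm_apply contDiffOn_const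
  refine h1.congr fun z hz => hDt_eq ?_
  exact (h.contDiffAt (hU.mem_nhds hz)).differentiableAt (by simp)

lemma hDx_contDiff {u : ℝ × ℝ → ℝ} (h : ContDiff ℝ (⊤ : ℕ∞) u) : ContDiff ℝ (⊤ : ℕ∞) (hDx u) :=
  contDiffOn_univ.1 (hDx_contDiffOn isOpen_univ h.contDiffOn)

lemma hDt_contDiff {u : ℝ × ℝ → ℝ} (h : ContDiff ℝ (⊤ : ℕ∞) u) : ContDiff ℝ (⊤ : ℕ∞) (hDt u) :=
  contDiffOn_univ.1 (hDt_contDiffOn isOpen_univ h.contDiffOn)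

lemma hDx_congr {u v : ℝ × ℝ → ℝ} {z : ℝ × ℝ} (h : u =ᶠ[𝓝 z] v) : hDx u z = hDx v z := by
  unfold hDx
  apply Filter.EventuallyEq.deriv_eq
  have : Tendsto (fun y : ℝ => (y, z.2)) (𝓝 z.1) (𝓝 z) := by
    have : Continuous (fun y : ℝ => (y, z.2)) := by fun_prop
    simpa using this.tendsto z.1
  exact this.eventually h

lemma hDt_congr {u v : ℝ × ℝ → ℝ} {z : ℝ × ℝ} (h : u =ᶠ[𝓝 z] v) : hDt u z = hDt v z := by
  unfold hDt
  apply Filter.EventuallyEq.deriv_eq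
  have : Tendsto (fun y : ℝ => (z.1, y)) (𝓝 z.2) (𝓝 z) := by
    have : Continuous (fun y : ℝ => (z.1, y)) := by fun_prop
    simpa using this.tendsto z.2
  exact this.eventually h

lemma hDx_congr' {u v : ℝ × ℝ → ℝ} {z : ℝ × ℝ} (h : u =ᶠ[𝓝 z] v) : hDx u =ᶠ[𝓝 z] hDx v := by
  filter_upwards [h.eventuallyEq_nhds] with w hw using hDx_congr hw

lemma hDx_zero (z : ℝ × ℝ) : hDx (fun _ => 0) z = 0 := by simp [hDx]
lemma hDt_zero (z : ℝ × ℝ) : hDt (fun _ => 0) z = 0 := by simp [hDt]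

lemma tsupport_hDx (u : ℝ × ℝ → ℝ) : tsupport (hDx u) ⊆ tsupport u := by
  intro z hz
  by_contra h
  rw [notMem_tsupport_iff_eventuallyEq] at h
  refine absurd hz ?_
  rw [notMem_tsupport_iff_eventuallyEq]
  filter_upwards [h.eventuallyEq_nhds] with w hw
  rw [hDx_congr hw]; exact hDx_zero w

lemma tsupport_hDt (u : ℝ × ℝ → ℝ) : tsupport (hDt u) ⊆ tsupport u := by
  intro z hz
  by_contra h
  rw [notMem_tsupport_iff_eventuallyEq] at h
  refine absurd hz ?_
  rw [notMem_tsupport_iff_eventuallyEq]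
  filter_upwards [h.eventuallyEq_nhds] with w hw
  rw [hDt_congr hw]; exact hDt_zero w

lemma int_mul_cs {u ζ : ℝ × ℝ → ℝ} {U : Set (ℝ × ℝ)} (hU : IsOpen U)
    (hu : ContinuousOn u U) (hζ : Continuous ζ) (hc : HasCompactSupport ζ) (hs : tsupport ζ ⊆ U) :
    Integrable (fun z => u z * ζ z) := by
  have hcont : Continuous (fun z => u z * ζ z) := by
    rw [continuous_iff_continuousAt]
    intro z
    by_cases hz : z ∈ tsupport ζ
    · exact ((hu.continuousAt (hU.mem_nhds (hs hz))).mul hζ.continuousAt)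
    · rw [notMem_tsupport_iff_eventuallyEq] at hz
      have : (fun z => u z * ζ z) =ᶠ[𝓝 z] fun _ => 0 := by
        filter_upwards [hz] with w hw; simp [hw]
      exact continuousAt_const.congr this.symm
  exact hcont.integrable_of_hasCompactSupport hc.mul_left

lemma ibp_heat {u ζ : ℝ × ℝ → ℝ} {U : Set (ℝ × ℝ)} (hU : IsOpen U)
    (hu : ContDiffOn ℝ (⊤ : ℕ∞) u U) (hh : ∀ z ∈ U, hDt u z = hDx (hDx u) z)
    (hζ : ContDiff ℝ (⊤ : ℕ∞) ζ) (hc : HasCompactSupport ζ) (hs : tsupport ζ ⊆ U) :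
    ∫ z, u z * (hDt ζ z + hDx (hDx ζ) z) = 0 := by
  have key : ∀ (v g : ℝ × ℝ → ℝ), ContDiffOn ℝ (⊤ : ℕ∞) v U → ContDiff ℝ (⊤ : ℕ∞) g →
      HasCompactSupport g → tsupport g ⊆ U →
      (∫ z, v z * hDx g z = - ∫ z, hDx v z * g z) ∧ (∫ z, v z * hDt g z = - ∫ z, hDt v z * g z) := by
    intro v g hv hg hgc hgs
    have dv : ∀ z ∈ tsupport g, DifferentiableAt ℝ v z := fun z hz =>
      (hv.contDiffAt (hU.mem_nhds (hgs hz))).differentiableAt (by simp)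
    have dg : ∀ z, DifferentiableAt ℝ g z := fun z => hg.contDiffAt.differentiableAt (by simp)
    constructor
    · refine integral_bilinear_hasLineDerivAt_right_eq_neg_left_of_integrable (v := ((1:ℝ),(0:ℝ)))
        (B := ContinuousLinearMap.mul ℝ ℝ) ?_ ?_ ?_ ?_ ?_
      · exact int_mul_cs hU (hDx_contDiffOn hU hv).continuousOn hg.continuous hgc hgs
      · exact int_mul_cs hU hv.continuousOn (hDx_contDiff hg).continuous
          (hgc.mono' (subset_closure.trans (tsupport_hDx g))) ((tsupport_hDx g).trans hgs)
      · exact int_mul_cs hU hv.continuousOn hg.continuous hgc hgs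
      · intro z hz
        rw [hDx_eq (dv z hz)]; exact (dv z hz).hasFDerivAt.hasLineDerivAt _
      · intro z hz
        rw [hDx_eq (dg z)]; exact (dg z).hasFDerivAt.hasLineDerivAt _
    · refine integral_bilinear_hasLineDerivAt_right_eq_neg_left_of_integrable (v := ((0:ℝ),(1:ℝ)))
        (B := ContinuousLinearMap.mul ℝ ℝ) ?_ ?_ ?_ ?_ ?_
      · exact int_mul_cs hU (hDt_contDiffOn hU hv).continuousOn hg.continuous hgc hgs
      · exact int_mul_cs hU hv.continuousOn (hDt_contDiff hg).continuous
          (hgc.mono' (subset_closure.trans (tsupport_hDt g))) ((tsupport_hDt g).trans hgs)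
      · exact int_mul_cs hU hv.continuousOn hg.continuous hgc hgs
      · intro z hz
        rw [hDt_eq (dv z hz)]; exact (dv z hz).hasFDerivAt.hasLineDerivAt _
      · intro z hz
        rw [hDt_eq (dg z)]; exact (dg z).hasFDerivAt.hasLineDerivAt _
  have cx : HasCompactSupport (hDx ζ) := hc.mono' (subset_closure.trans (tsupport_hDx ζ))
  have cxx : HasCompactSupport (hDx (hDx ζ)) := cx.mono' (subset_closure.trans (tsupport_hDx _))
  have ct : HasCompactSupport (hDt ζ) := hc.mono' (subset_closure.trans (tsupport_hDt ζ))
  have sx := (tsupport_hDx ζ).trans hs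
  have i1 := int_mul_cs hU hu.continuousOn (hDt_contDiff hζ).continuous ct ((tsupport_hDt ζ).trans hs)
  have i2 := int_mul_cs hU hu.continuousOn (hDx_contDiff (hDx_contDiff hζ)).continuous cxx
    ((tsupport_hDx _).trans sx)
  simp only [mul_add]
  rw [integral_add i1 i2, (key u ζ hu hζ hc hs).2, (key u (hDx ζ) hu (hDx_contDiff hζ) cx sx).1,
    (key (hDx u) ζ (hDx_contDiffOn hU hu) hζ hc hs).1, neg_neg, neg_add_eq_zero]
  apply integral_congr_ae
  filter_upwards with z
  by_cases hz : z ∈ U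
  · simp only [hh z hz]
  · rw [image_eq_zero_of_notMem_tsupport (fun h => hz (hs h))]; simp

section glue
open Polynomial Real

/-- `s^{-1/2} exp(-1/s)` extended by zero -/
noncomputable def hGlue (s : ℝ) : ℝ := √(s⁻¹) * expNegInvGlue s

lemma hGlue_nonpos {s : ℝ} (hs : s ≤ 0) : hGlue s = 0 := by
  simp [hGlue, expNegInvGlue.zero_of_nonpos hs]

lemma hGlue_tendsto (p : ℝ[X]) :
    Tendsto (fun x ↦ p.eval x⁻¹ * hGlue x) (𝓝 0) (𝓝 0) := by
  have h1 := (expNegInvGlue.tendsto_polynomial_inv_mul_zero p).norm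
  have h2 := (expNegInvGlue.tendsto_polynomial_inv_mul_zero (p * X)).norm
  have h3 := h1.add h2
  simp only [norm_zero, add_zero] at h3
  refine squeeze_zero_norm (fun x => ?_) h3
  simp only [hGlue, norm_mul, Real.norm_eq_abs, eval_mul, eval_X]
  have : |√(x⁻¹)| ≤ 1 + |x⁻¹| := by
    rw [abs_of_nonneg (Real.sqrt_nonneg _)]
    apply Real.sqrt_le_iff.2
    refine ⟨by positivity, ?_⟩
    nlinarith [le_abs_self x⁻¹, abs_nonneg x⁻¹]
  calc |eval x⁻¹ p| * (|√(x⁻¹)| * |expNegInvGlue x|)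
      ≤ |eval x⁻¹ p| * ((1 + |x⁻¹|) * |expNegInvGlue x|) := by gcongr
    _ = _ := by ring

lemma hGlue_hasDerivAt (p : ℝ[X]) (x : ℝ) :
    HasDerivAt (fun x ↦ p.eval x⁻¹ * hGlue x)
      ((X ^ 2 * (p - derivative (R := ℝ) p) - C (1/2) * X * p).eval x⁻¹ * hGlue x) x := by
  rcases lt_trichotomy x 0 with hx | rfl | hx
  · rw [hGlue_nonpos hx.le, mul_zero]
    refine (hasDerivAt_const _ 0).congr_of_eventuallyEq ?_
    filter_upwards [gt_mem_nhds hx] with y hy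
    rw [hGlue_nonpos hy.le, mul_zero]
  · rw [hGlue_nonpos le_rfl, mul_zero, hasDerivAt_iff_tendsto_slope]
    refine ((hGlue_tendsto (p * X)).mono_left inf_le_left).congr fun x ↦ ?_
    simp [slope_def_field, div_eq_mul_inv, mul_right_comm, hGlue_nonpos le_rfl]
  · have hs : HasDerivAt (fun x : ℝ => √(x⁻¹)) _ x :=
      (hasDerivAt_inv hx.ne').sqrt (inv_ne_zero hx.ne')
    have := hs.mul (expNegInvGlue.hasDerivAt_polynomial_eval_inv_mul p x)
    have e : (fun x ↦ p.eval x⁻¹ * hGlue x) = (fun x : ℝ => √(x⁻¹)) * (fun x ↦ p.eval x⁻¹ * expNegInvGlue x) := by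
      funext y; simp [hGlue]; ring
    rw [e]
    refine this.congr_deriv ?_
    have hq : √(x⁻¹) * √(x⁻¹) = x⁻¹ := Real.mul_self_sqrt (by positivity)
    have hq0 : 0 < √(x⁻¹) := Real.sqrt_pos.2 (by positivity)
    have e1 : -(x ^ 2)⁻¹ / (2 * √(x⁻¹)) = - (1/2) * x⁻¹ * √(x⁻¹) := by
      rw [div_eq_iff (by positivity)]
      have : (x^2)⁻¹ = x⁻¹ * x⁻¹ := by rw [sq, mul_inv]
      rw [this]
      linear_combination x⁻¹ * hq
    rw [e1]
    simp [hGlue]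
    ring

lemma hGlue_contDiff_aux (p : ℝ[X]) {n : ℕ∞} :
    ContDiff ℝ n (fun x ↦ p.eval x⁻¹ * hGlue x) := by
  apply contDiff_all_iff_nat.2 (fun m => ?_) n
  induction m generalizing p with
  | zero => exact contDiff_zero.2 (continuous_iff_continuousAt.2 fun x => (hGlue_hasDerivAt p x).continuousAt)
  | succ m ihm =>
    rw [show ((m + 1 : ℕ) : WithTop ℕ∞) = m + 1 from rfl]
    refine contDiff_succ_iff_deriv.2 ⟨fun x => (hGlue_hasDerivAt p x).differentiableAt, by simp, ?_⟩
    convert! ihm (X ^ 2 * (p - derivative (R := ℝ) p) - C (1/2) * X * p) using 2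
    exact (hGlue_hasDerivAt p _).deriv

lemma hGlue_contDiff : ContDiff ℝ (⊤ : ℕ∞) hGlue := by
  simpa using hGlue_contDiff_aux 1

end glue

/-- heat kernel, extended by zero to nonpositive times -/
noncomputable def hK (z : ℝ × ℝ) : ℝ :=
  if 0 < z.2 then (√(4 * Real.pi * z.2))⁻¹ * Real.exp (- z.1 ^ 2 / (4 * z.2)) else 0

lemma hK_eq_glue {z : ℝ × ℝ} (hz : z.1 ≠ 0) :
    hK z = (√Real.pi)⁻¹ * |z.1|⁻¹ * hGlue (4 * z.2 / z.1 ^ 2) := by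
  unfold hK
  split_ifs with h
  · have h2 : 0 < z.1 ^ 2 := by positivity
    have hpos : 0 < 4 * z.2 / z.1 ^ 2 := by positivity
    have e1 : √((4 * z.2 / z.1 ^ 2)⁻¹) = |z.1| * (√(4 * z.2))⁻¹ := by
      rw [inv_div, Real.sqrt_div (sq_nonneg _), Real.sqrt_sq_eq_abs, div_eq_mul_inv]
    have e2 : √(4 * Real.pi * z.2) = √Real.pi * √(4 * z.2) := by
      rw [← Real.sqrt_mul Real.pi_pos.le]; ring_nf
    have e3 : expNegInvGlue (4 * z.2 / z.1 ^ 2) = Real.exp (- z.1 ^ 2 / (4 * z.2)) := by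
      rw [expNegInvGlue, if_neg (not_le.2 hpos), inv_div, neg_div]
    have : |z.1| ≠ 0 := abs_ne_zero.2 hz
    rw [hGlue, e1, e2, e3, mul_inv]
    field_simp
  · rw [hGlue_nonpos, mul_zero]
    apply div_nonpos_of_nonpos_of_nonneg <;> nlinarith [sq_nonneg z.1]

lemma hK_contDiffOn : ContDiffOn ℝ (⊤ : ℕ∞) hK ({0}ᶜ) := by
  intro z hz
  apply ContDiffAt.contDiffWithinAt
  by_cases h1 : z.1 = 0
  · have h2 : z.2 ≠ 0 := fun h => hz (Prod.ext h1 h)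
    rcases lt_or_gt_of_ne h2 with h | h
    · have : hK =ᶠ[𝓝 z] fun _ => 0 := by
        have : ∀ᶠ w : ℝ × ℝ in 𝓝 z, w.2 < 0 := continuous_snd.continuousAt.eventually (gt_mem_nhds h)
        filter_upwards [this] with w hw
        simp [hK, not_lt.2 hw.le]
      exact contDiffAt_const.congr_of_eventuallyEq this
    · have : hK =ᶠ[𝓝 z] fun w => (√(4 * Real.pi * w.2))⁻¹ * Real.exp (- w.1 ^ 2 / (4 * w.2)) := by
        have : ∀ᶠ w : ℝ × ℝ in 𝓝 z, 0 < w.2 := continuous_snd.continuousAt.eventually (lt_mem_nhds h)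
        filter_upwards [this] with w hw
        simp [hK, hw]
      refine ContDiffAt.congr_of_eventuallyEq ?_ this
      have hp : 0 < 4 * Real.pi * z.2 := by have := Real.pi_pos; positivity
      refine ContDiffAt.mul (ContDiffAt.inv (ContDiffAt.sqrt (by fun_prop) hp.ne') (Real.sqrt_pos.2 hp).ne') ?_
      refine ContDiffAt.exp (ContDiffAt.div (by fun_prop) (by fun_prop) (by positivity))
  · have : hK =ᶠ[𝓝 z] fun w => (√Real.pi)⁻¹ * |w.1|⁻¹ * hGlue (4 * w.2 / w.1 ^ 2) := by
      have : ∀ᶠ w : ℝ × ℝ in 𝓝 z, w.1 ≠ 0 := continuous_fst.continuousAt.eventually_ne h1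
      filter_upwards [this] with w hw
      exact hK_eq_glue hw
    refine ContDiffAt.congr_of_eventuallyEq ?_ this
    refine ContDiffAt.mul (contDiffAt_const.mul (ContDiffAt.inv ?_ (abs_ne_zero.2 h1))) ?_
    · exact (contDiffAt_abs h1).comp z contDiffAt_fst
    · exact hGlue_contDiff.contDiffAt.comp z (ContDiffAt.div (by fun_prop) (by fun_prop) (by positivity))

lemma hK_hasDerivAt_x {x t : ℝ} (ht : 0 < t) :
    HasDerivAt (fun y => hK (y, t)) (-(x / (2 * t)) * hK (x, t)) x := by
  have e : (fun y => hK (y, t)) = fun y => (√(4 * Real.pi * t))⁻¹ * Real.exp (- y ^ 2 / (4 * t)) := by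
    funext y; simp [hK, ht]
  have h : HasDerivAt (fun y : ℝ => - y ^ 2 / (4 * t)) (-(x / (2 * t))) x := by
    have := ((hasDerivAt_pow 2 x).neg).div_const (4 * t)
    refine this.congr_deriv ?_
    field_simp; norm_num; ring
  rw [e]
  refine (h.exp.const_mul _).congr_deriv ?_
  simp [hK, ht]; ring

lemma hK_hasDerivAt_t {x t : ℝ} (ht : 0 < t) :
    HasDerivAt (fun s => hK (x, s)) ((x^2 / (4 * t^2) - 1 / (2 * t)) * hK (x, t)) t := by
  have e : (fun s => hK (x, s)) =ᶠ[𝓝 t] fun s => (√(4 * Real.pi * s))⁻¹ * Real.exp (- x ^ 2 / (4 * s)) := by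
    filter_upwards [lt_mem_nhds ht] with s hs
    simp [hK, hs]
  have hp : 0 < 4 * Real.pi * t := by have := Real.pi_pos; positivity
  have hr : 0 < √(4 * Real.pi * t) := Real.sqrt_pos.2 hp
  have h1 : HasDerivAt (fun s => (√(4 * Real.pi * s))⁻¹) _ t :=
    (((hasDerivAt_id t).const_mul (4 * Real.pi)).sqrt hp.ne').inv hr.ne'
  have h2 : HasDerivAt (fun s : ℝ => - x ^ 2 / (4 * s)) _ t :=
    (hasDerivAt_const t (- x^2)).div ((hasDerivAt_id t).const_mul 4) (by simpa using ht.ne')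
  refine HasDerivAt.congr_of_eventuallyEq ?_ e
  refine (h1.mul h2.exp).congr_deriv ?_
  have hs : √(4 * Real.pi * t) ^ 2 = 4 * Real.pi * t := Real.sq_sqrt hp.le
  simp only [hK, ht, if_true, id, mul_one]
  rw [hs]
  have := Real.pi_pos
  field_simp
  ring

lemma hK_heat {z : ℝ × ℝ} (ht : 0 < z.2) : hDt hK z = hDx (hDx hK) z := by
  obtain ⟨x, t⟩ := z
  simp only at ht
  have h1 : hDt hK (x, t) = (x^2 / (4 * t^2) - 1 / (2 * t)) * hK (x, t) := (hK_hasDerivAt_t ht).deriv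
  have h2 : (fun y => hDx hK (y, t)) = fun y => -(y / (2 * t)) * hK (y, t) := by
    funext y; exact (hK_hasDerivAt_x ht).deriv
  rw [h1, hDx]
  simp only [h2]
  have h3 := (((hasDerivAt_id x).div_const (2 * t)).neg).mul (hK_hasDerivAt_x (x := x) ht)
  symm
  refine (h3.congr_deriv ?_).deriv
  simp; field_simp; ring

lemma int_mul_bdd {u g : ℝ × ℝ → ℝ} (hu : Integrable u) (c : ℝ) (hg : Continuous g)
    (hb : ∀ z, ‖g z‖ ≤ c) : Integrable (fun z => u z * g z) :=
  hu.mul_bdd hg.aestronglyMeasurable (ae_of_all _ hb)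

/-- the even spatial cutoff -/
noncomputable def hEta (s : ℝ) : ℝ := Real.smoothTransition (s ^ 2 - 1)

lemma hEta_contDiff : ContDiff ℝ (⊤ : ℕ∞) hEta :=
  Real.smoothTransition.contDiff.comp (by fun_prop)

lemma hEta_zero {s : ℝ} (h : |s| ≤ 1) : hEta s = 0 := by
  apply Real.smoothTransition.zero_of_nonpos
  have := (sq_le_one_iff_abs_le_one s).2 h
  linarith

lemma hEta_one {s : ℝ} (h : 2 ≤ s ^ 2) : hEta s = 1 := by
  apply Real.smoothTransition.one_of_one_le
  linarith

lemma hEta_deriv_contDiff : ContDiff ℝ (⊤ : ℕ∞) (deriv hEta) := by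
  have := hEta_contDiff
  exact (contDiff_infty_iff_deriv.1 this).2

lemma hEta_deriv2_contDiff : ContDiff ℝ (⊤ : ℕ∞) (deriv (deriv hEta)) :=
  (contDiff_infty_iff_deriv.1 hEta_deriv_contDiff).2

lemma hEta_deriv_zero {s : ℝ} (h : 2 < s ^ 2) : deriv hEta s = 0 := by
  have : hEta =ᶠ[𝓝 s] fun _ => 1 := by
    have : ∀ᶠ y : ℝ in 𝓝 s, 2 < y ^ 2 := (continuous_pow 2).continuousAt.eventually (lt_mem_nhds h)
    filter_upwards [this] with y hy using hEta_one hy.le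
  rw [this.deriv_eq]; simp

lemma hEta_deriv2_zero {s : ℝ} (h : 2 < s ^ 2) : deriv (deriv hEta) s = 0 := by
  have : deriv hEta =ᶠ[𝓝 s] fun _ => 0 := by
    have : ∀ᶠ y : ℝ in 𝓝 s, 2 < y ^ 2 := (continuous_pow 2).continuousAt.eventually (lt_mem_nhds h)
    filter_upwards [this] with y hy using hEta_deriv_zero hy
  rw [this.deriv_eq]; simp

lemma hEta_deriv2_even (s : ℝ) : deriv (deriv hEta) (-s) = deriv (deriv hEta) s := by
  have h0 : (fun y => hEta (-y)) = hEta := by funext y; simp [hEta]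
  have h1 : ∀ y, deriv hEta (-y) = - deriv hEta y := by
    intro y
    have := deriv_comp_neg hEta y
    rw [h0] at this; linarith
  have h2 := deriv_comp_neg (deriv hEta) s
  have h3 : (fun y => deriv hEta (-y)) = fun y => - deriv hEta y := funext h1
  rw [h3, deriv.fun_neg] at h2
  linarith

lemma bdd_cs {g : ℝ → ℝ} (hg : Continuous g) (h : ∀ s : ℝ, 2 < s ^ 2 → g s = 0) :
    ∃ A, 0 ≤ A ∧ ∀ s, |g s| ≤ A := by
  have hc : HasCompactSupport g := HasCompactSupport.intro (isCompact_Icc (a := (-2:ℝ)) (b := 2)) (by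
    intro s hs
    apply h
    by_contra hcon
    apply hs
    constructor <;> nlinarith)
  obtain ⟨A, hA⟩ := hg.bounded_above_of_compact_support hc
  exact ⟨A, (norm_nonneg _).trans (hA 0), hA⟩

lemma hEta_bounds : ∃ A, 0 ≤ A ∧ (∀ s, |deriv hEta s| ≤ A) ∧ ∀ s, |deriv (deriv hEta) s| ≤ A := by
  obtain ⟨A, hA0, hA⟩ := bdd_cs hEta_deriv_contDiff.continuous fun s => hEta_deriv_zero
  obtain ⟨B, hB0, hB⟩ := bdd_cs hEta_deriv2_contDiff.continuous fun s => hEta_deriv2_zero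
  exact ⟨A + B, by positivity, fun s => (hA s).trans (by linarith), fun s => (hB s).trans (by linarith)⟩

/-- product rule with a spatial cutoff -/
lemma hL_cutoff {φ : ℝ × ℝ → ℝ} (hφ : ContDiff ℝ (⊤ : ℕ∞) φ) (ε : ℝ) (z : ℝ × ℝ) :
    hDt (fun z => hEta (z.1 / ε) * φ z) z + hDx (hDx (fun z => hEta (z.1 / ε) * φ z)) z
     = hEta (z.1 / ε) * (hDt φ z + hDx (hDx φ) z) + 2 * (deriv hEta (z.1 / ε) / ε) * hDx φ z
       + deriv (deriv hEta) (z.1 / ε) / ε / ε * φ z := by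
  obtain ⟨x, t⟩ := z
  have d0 : ∀ y, HasDerivAt (fun y => hEta (y / ε)) (deriv hEta (y / ε) / ε) y := by
    intro y
    have h := (hEta_contDiff.contDiffAt (x := y / ε)).differentiableAt (by simp)
    have := h.hasDerivAt.comp y ((hasDerivAt_id y).div_const ε)
    refine this.congr_deriv ?_
    simp [div_eq_mul_inv]
  have d1 : ∀ y, HasDerivAt (fun y => deriv hEta (y / ε) / ε) (deriv (deriv hEta) (y / ε) / ε / ε) y := by
    intro y
    have h := (hEta_deriv_contDiff.contDiffAt (x := y / ε)).differentiableAt (by simp)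
    have := (h.hasDerivAt.comp y ((hasDerivAt_id y).div_const ε)).div_const ε
    refine this.congr_deriv ?_
    simp [div_eq_mul_inv]
  have dx : ∀ (v : ℝ × ℝ → ℝ), ContDiff ℝ (⊤ : ℕ∞) v → ∀ y, HasDerivAt (fun y => v (y, t)) (hDx v (y, t)) y := by
    intro v hv y
    have h := (hv.contDiffAt (x := (y, t))).differentiableAt (by simp)
    rw [hDx_eq h]; exact hDx_hasDerivAt h
  have e1 : hDt (fun z => hEta (z.1 / ε) * φ z) (x, t) = hEta (x / ε) * hDt φ (x, t) := by
    simp [hDt]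
  have e2 : (fun y => hDx (fun z => hEta (z.1 / ε) * φ z) (y, t)) = fun y =>
      deriv hEta (y / ε) / ε * φ (y, t) + hEta (y / ε) * hDx φ (y, t) := by
    funext y
    exact ((d0 y).mul (dx φ hφ y)).deriv
  have e3 : hDx (hDx (fun z => hEta (z.1 / ε) * φ z)) (x, t) =
     (deriv (deriv hEta) (x / ε) / ε / ε * φ (x, t) + deriv hEta (x / ε) / ε * hDx φ (x, t))
      + (deriv hEta (x / ε) / ε * hDx φ (x, t) + hEta (x / ε) * hDx (hDx φ) (x, t)) := by
    rw [hDx]; simp only [e2]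
    exact (((d1 x).mul (dx φ hφ x)).add ((d0 x).mul (dx _ (hDx_contDiff hφ) x))).deriv
  rw [e1, e3]; ring

lemma integral_reflect (g : ℝ × ℝ → ℝ) : ∫ z : ℝ × ℝ, g (-z.1, z.2) = ∫ z, g z := by
  have h : MeasurePreserving (Prod.map (fun x : ℝ => -x) (id : ℝ → ℝ)) (volume : Measure (ℝ × ℝ)) volume :=
    (Measure.measurePreserving_neg (volume : Measure ℝ)).prod (MeasurePreserving.id volume)
  have he : MeasurableEmbedding (Prod.map (fun x : ℝ => -x) (id : ℝ → ℝ)) :=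
    ((MeasurableEquiv.neg ℝ).prodCongr (MeasurableEquiv.refl ℝ)).measurableEmbedding
  exact h.integral_comp he g

lemma weak_heat {Q : Set (ℝ × ℝ)} (hQ : IsOpen Q) {u : ℝ × ℝ → ℝ}
    (hu : ContDiffOn ℝ (⊤ : ℕ∞) u (Q ∩ {z | z.1 ≠ 0}))
    (hh : ∀ z ∈ Q ∩ {z | z.1 ≠ 0}, hDt u z = hDx (hDx u) z)
    (hodd : ∀ x t, u (-x, t) = - u (x, t))
    (hIntg : Integrable u)
    (hdec : Tendsto (fun τ : ℝ => τ⁻¹ * ∫ z in {z : ℝ × ℝ | |z.1| < τ}, |u z|) (𝓝[>] 0) (𝓝 0))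
    {φ : ℝ × ℝ → ℝ} (hφ : ContDiff ℝ (⊤ : ℕ∞) φ) (hc : HasCompactSupport φ) (hs : tsupport φ ⊆ Q) :
    ∫ z, u z * (hDt φ z + hDx (hDx φ) z) = 0 := by
  have hU : IsOpen (Q ∩ {z : ℝ × ℝ | z.1 ≠ 0}) :=
    hQ.inter (isOpen_ne.preimage continuous_fst)
  obtain ⟨A, hA0, hA1, hA2⟩ := hEta_bounds
  have cφx : HasCompactSupport (hDx φ) := hc.mono' (subset_closure.trans (tsupport_hDx φ))
  have cφxx : HasCompactSupport (hDx (hDx φ)) := cφx.mono' (subset_closure.trans (tsupport_hDx _))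
  have cφt : HasCompactSupport (hDt φ) := hc.mono' (subset_closure.trans (tsupport_hDt φ))
  obtain ⟨B, hB⟩ := (hDx_contDiff hφ).continuous.bounded_above_of_compact_support cφx
  obtain ⟨B0, hB0⟩ := hφ.continuous.bounded_above_of_compact_support hc
  have hBn : 0 ≤ B := (norm_nonneg _).trans (hB 0)
  set Lφ : ℝ × ℝ → ℝ := fun z => hDt φ z + hDx (hDx φ) z with hLφ
  have cL : HasCompactSupport Lφ := cφt.add cφxx
  have contL : Continuous Lφ := (hDt_contDiff hφ).continuous.add (hDx_contDiff (hDx_contDiff hφ)).continuous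
  obtain ⟨BL, hBL⟩ := contL.bounded_above_of_compact_support cL
  have hIL : Integrable (fun z => u z * Lφ z) := int_mul_bdd hIntg BL contL hBL
  have hu0 : ∀ t, u (0, t) = 0 := by
    intro t; have := hodd 0 t; simp at this; linarith
  have cη : Continuous hEta := hEta_contDiff.continuous
  have cη1 : Continuous (deriv hEta) := hEta_deriv_contDiff.continuous
  have cη2 : Continuous (deriv (deriv hEta)) := hEta_deriv2_contDiff.continuous
  have hηb : ∀ s, |hEta s| ≤ 1 := fun s => abs_le.2
    ⟨(by norm_num : (-1:ℝ) ≤ 0).trans (Real.smoothTransition.nonneg (s^2-1)),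
      Real.smoothTransition.le_one _⟩
  have hLip : ∀ z : ℝ × ℝ, |φ z - φ (-z.1, z.2)| ≤ B * (2 * |z.1|) := by
    rintro ⟨x, t⟩
    have := Convex.norm_image_sub_le_of_norm_deriv_le (𝕜 := ℝ) (f := fun y => φ (y, t)) (s := univ)
      (C := B) (x := -x) (y := x) ?_ ?_ convex_univ (mem_univ _) (mem_univ _)
    · simp only [Real.norm_eq_abs, sub_neg_eq_add, ← two_mul, abs_mul, abs_two] at this
      exact this
    · intro y _
      exact (hDx_hasDerivAt ((hφ.contDiffAt (x := (y, t))).differentiableAt (by simp))).differentiableAt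
    · intro y _; exact hB (y, t)
  -- first limit
  have lim1 : Tendsto (fun ε : ℝ => ∫ z, u z * (hEta (z.1 / ε) * Lφ z)) (𝓝[>] 0)
      (𝓝 (∫ z, u z * Lφ z)) := by
    apply tendsto_integral_filter_of_dominated_convergence (fun z => |u z * Lφ z|)
    · filter_upwards with ε
      exact hIntg.aestronglyMeasurable.mul (by fun_prop : Continuous _).aestronglyMeasurable
    · filter_upwards with ε
      filter_upwards with z
      rw [Real.norm_eq_abs, abs_mul, abs_mul, abs_mul]
      have := mul_le_mul_of_nonneg_right (hηb (z.1 / ε)) (abs_nonneg (Lφ z))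
      gcongr; linarith
    · exact hIL.abs
    · filter_upwards with z
      by_cases hz : z.1 = 0
      · have : u z = 0 := by rw [show z = (0, z.2) from Prod.ext hz rfl]; exact hu0 z.2
        simp [this]
      · apply tendsto_const_nhds.congr'
        have : ∀ᶠ ε : ℝ in 𝓝[>] 0, ε < |z.1| / 2 :=
          nhdsWithin_le_nhds (gt_mem_nhds (by positivity))
        filter_upwards [this, self_mem_nhdsWithin] with ε h1 h2
        have h2 : 0 < ε := h2
        rw [hEta_one, one_mul]
        rw [div_pow, le_div_iff₀ (by positivity)]
        rw [← sq_abs z.1]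
        nlinarith [abs_pos.2 hz]
  -- second limit
  have lim2 : Tendsto (fun ε : ℝ => ∫ z, u z * (hEta (z.1 / ε) * Lφ z)) (𝓝[>] 0) (𝓝 0) := by
    have hdec2 : Tendsto (fun ε : ℝ => 8 * A * B * ((2 * ε)⁻¹ * ∫ z in {z : ℝ × ℝ | |z.1| < 2 * ε}, |u z|))
        (𝓝[>] 0) (𝓝 0) := by
      have h2 : Tendsto (fun ε : ℝ => 2 * ε) (𝓝[>] 0) (𝓝[>] 0) := by
        apply tendsto_nhdsWithin_iff.2
        constructor
        · have : Tendsto (fun ε : ℝ => 2 * ε) (𝓝 0) (𝓝 (2 * 0)) := (continuous_const_mul 2).tendsto 0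
          rw [mul_zero] at this
          exact this.mono_left nhdsWithin_le_nhds
        · filter_upwards [self_mem_nhdsWithin] with ε hε
          have : (0:ℝ) < ε := hε
          exact mem_Ioi.2 (by positivity)
      have := (hdec.comp h2).const_mul (8 * A * B)
      simpa using this
    refine squeeze_zero_norm' ?_ hdec2
    filter_upwards [self_mem_nhdsWithin] with ε hε
    have hε : 0 < ε := hε
    have hζ : ContDiff ℝ (⊤ : ℕ∞) (fun z : ℝ × ℝ => hEta (z.1 / ε) * φ z) :=
      (hEta_contDiff.comp (by fun_prop)).mul hφ
    have hζc : HasCompactSupport (fun z : ℝ × ℝ => hEta (z.1 / ε) * φ z) := hc.mul_left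
    have hζs : tsupport (fun z : ℝ × ℝ => hEta (z.1 / ε) * φ z) ⊆ Q ∩ {z | z.1 ≠ 0} := by
      intro z hz
      refine ⟨hs (tsupport_mul_subset_right hz), ?_⟩
      have hcl : IsClosed {z : ℝ × ℝ | ε ≤ |z.1|} := isClosed_le (by fun_prop) (by fun_prop)
      have : z ∈ {z : ℝ × ℝ | ε ≤ |z.1|} := by
        refine closure_minimal ?_ hcl hz
        intro w hw
        by_contra hcon
        simp only [mem_ofPred_eq, not_le] at hcon
        apply hw
        simp only
        rw [hEta_zero, zero_mul]
        rw [abs_div, abs_of_pos hε, div_le_one hε]; exact hcon.le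
      intro h0
      simp only [mem_ofPred_eq, h0, abs_zero] at this
      linarith
    have h0 := ibp_heat hU hu hh hζ hζc hζs
    simp only [hL_cutoff hφ ε] at h0
    -- the pieces
    obtain ⟨Cη, hCη⟩ : ∃ c : ℝ, ∀ z : ℝ × ℝ, ‖hEta (z.1 / ε) * Lφ z‖ ≤ c := ⟨BL, fun z => by
      rw [norm_mul]
      have := mul_le_mul_of_nonneg_right (hηb (z.1 / ε)) (norm_nonneg (Lφ z))
      rw [Real.norm_eq_abs (hEta _)]; linarith [hBL z]⟩
    have i1 : Integrable (fun z => u z * (hEta (z.1 / ε) * Lφ z)) :=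
      int_mul_bdd hIntg Cη (by fun_prop) hCη
    have i2 : Integrable (fun z => u z * (2 * (deriv hEta (z.1 / ε) / ε) * hDx φ z)) := by
      refine int_mul_bdd hIntg (2 * (A / ε) * B) ?_ (fun z => ?_)
      · have := (hDx_contDiff hφ).continuous
        fun_prop
      · rw [norm_mul, norm_mul, norm_div, Real.norm_eq_abs 2, Real.norm_eq_abs ε, abs_two, abs_of_pos hε]
        gcongr
        · exact hA1 _
        · exact hB z
    have i3 : Integrable (fun z => u z * (deriv (deriv hEta) (z.1 / ε) / ε / ε * φ z)) := by
      refine int_mul_bdd hIntg (A / ε / ε * B0) ?_ (fun z => ?_)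
      · have := hφ.continuous
        fun_prop
      · rw [norm_mul, norm_div, norm_div, Real.norm_eq_abs ε, abs_of_pos hε]
        gcongr
        · exact hA2 _
        · exact hB0 z
    have hr := integral_reflect (fun z => u z * (deriv (deriv hEta) (z.1 / ε) / ε / ε * φ z))
    have i3' : Integrable (fun z : ℝ × ℝ => u z * (deriv (deriv hEta) (z.1 / ε) / ε / ε * φ (-z.1, z.2))) := by
      refine int_mul_bdd hIntg (A / ε / ε * B0) ?_ (fun z => ?_)
      · have := hφ.continuous
        fun_prop
      · rw [norm_mul, norm_div, norm_div, Real.norm_eq_abs ε, abs_of_pos hε]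
        gcongr
        · exact hA2 _
        · exact hB0 _
    have hr2 : ∀ z : ℝ × ℝ, u (-z.1, z.2) * (deriv (deriv hEta) (-z.1 / ε) / ε / ε * φ (-z.1, z.2))
        = - (u z * (deriv (deriv hEta) (z.1 / ε) / ε / ε * φ (-z.1, z.2))) := by
      intro z
      rw [hodd, neg_div, hEta_deriv2_even]; ring
    simp only [hr2] at hr
    rw [integral_neg] at hr
    have key : ∫ z, u z * (hEta (z.1 / ε) * Lφ z) =
        - ∫ z, u z * (2 * (deriv hEta (z.1 / ε) / ε) * hDx φ z
          + 1/2 * (deriv (deriv hEta) (z.1 / ε) / ε / ε * (φ z - φ (-z.1, z.2)))) := by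
      have e1 : ∫ z, u z * (hEta (z.1 / ε) * (hDt φ z + hDx (hDx φ) z) + 2 * (deriv hEta (z.1 / ε) / ε) * hDx φ z
       + deriv (deriv hEta) (z.1 / ε) / ε / ε * φ z) = (∫ z, u z * (hEta (z.1 / ε) * Lφ z))
        + (∫ z, u z * (2 * (deriv hEta (z.1 / ε) / ε) * hDx φ z))
        + ∫ z, u z * (deriv (deriv hEta) (z.1 / ε) / ε / ε * φ z) := by
        rw [← integral_add i1 i2, ← integral_add (by exact i1.add i2) i3]
        congr 1; funext z; simp only [hLφ]; ring
      have e2 : ∫ z, u z * (2 * (deriv hEta (z.1 / ε) / ε) * hDx φ z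
          + 1/2 * (deriv (deriv hEta) (z.1 / ε) / ε / ε * (φ z - φ (-z.1, z.2)))) =
          (∫ z, u z * (2 * (deriv hEta (z.1 / ε) / ε) * hDx φ z)) +
          1/2 * ((∫ z, u z * (deriv (deriv hEta) (z.1 / ε) / ε / ε * φ z))
            - ∫ z : ℝ × ℝ, u z * (deriv (deriv hEta) (z.1 / ε) / ε / ε * φ (-z.1, z.2))) := by
        rw [← integral_sub i3 i3', ← integral_const_mul, ← integral_add i2 (by exact (i3.sub i3').const_mul _)]
        congr 1; funext z; ring
      rw [e1] at h0
      rw [e2]; linarith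
    rw [key, norm_neg]
    have hset : MeasurableSet {z : ℝ × ℝ | |z.1| < 2 * ε} :=
      measurableSet_lt (by fun_prop) (by fun_prop)
    rw [← integral_indicator hset, ← integral_const_mul, ← integral_const_mul]
    apply norm_integral_le_of_norm_le
    · exact ((hIntg.abs.indicator hset).const_mul _).const_mul _
    · filter_upwards with z
      by_cases hz : |z.1| < 2 * ε
      · rw [indicator_of_mem (show z ∈ {z : ℝ × ℝ | |z.1| < 2 * ε} from hz), norm_mul, Real.norm_eq_abs (u z)]
        have b1 : ‖2 * (deriv hEta (z.1 / ε) / ε) * hDx φ z‖ ≤ 2 * (A / ε) * B := by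
          rw [norm_mul, norm_mul, norm_div, Real.norm_eq_abs 2, Real.norm_eq_abs ε, abs_two, abs_of_pos hε]
          gcongr
          · exact hA1 _
          · exact hB z
        have b2 : ‖1/2 * (deriv (deriv hEta) (z.1 / ε) / ε / ε * (φ z - φ (-z.1, z.2)))‖
            ≤ 1/2 * (A / ε / ε * (B * (2 * (2 * ε)))) := by
          rw [norm_mul, norm_mul, Real.norm_eq_abs (1/2), abs_of_pos (by norm_num : (0:ℝ) < 1/2),
            norm_div, norm_div, Real.norm_eq_abs ε, abs_of_pos hε]
          gcongr
          · exact hA2 _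
          · exact (hLip z).trans (by gcongr)
        have b3 := (norm_add_le _ _).trans (add_le_add b1 b2)
        have b4 : 2 * (A / ε) * B + 1/2 * (A / ε / ε * (B * (2 * (2 * ε)))) = 8 * A * B * (2 * ε)⁻¹ := by
          field_simp; norm_num; ring
        rw [b4] at b3
        calc _ ≤ |u z| * (8 * A * B * (2 * ε)⁻¹) := by gcongr
          _ = _ := by ring
      · rw [indicator_of_notMem (show z ∉ {z : ℝ × ℝ | |z.1| < 2 * ε} from hz)]
        have h2 : 2 < (z.1 / ε) ^ 2 := by
          rw [div_pow, lt_div_iff₀ (by positivity), ← sq_abs z.1]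
          nlinarith [not_lt.1 hz]
        rw [hEta_deriv_zero h2, hEta_deriv2_zero h2]
        simp
  exact tendsto_nhds_unique lim1 lim2

/-- time cutoff -/
noncomputable def hS (s : ℝ) : ℝ := Real.smoothTransition (s - 1)

lemma hS_contDiff : ContDiff ℝ (⊤ : ℕ∞) hS :=
  Real.smoothTransition.contDiff.comp (by fun_prop)

lemma hS_zero {s : ℝ} (h : s ≤ 1) : hS s = 0 :=
  Real.smoothTransition.zero_of_nonpos (by linarith)

lemma hS_one {s : ℝ} (h : 2 ≤ s) : hS s = 1 :=
  Real.smoothTransition.one_of_one_le (by linarith)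

lemma hS_deriv_contDiff : ContDiff ℝ (⊤ : ℕ∞) (deriv hS) :=
  (contDiff_infty_iff_deriv.1 hS_contDiff).2

lemma hS_deriv_zero {s : ℝ} (h : s < 1) : deriv hS s = 0 := by
  have : hS =ᶠ[𝓝 s] fun _ => 0 := by
    filter_upwards [gt_mem_nhds h] with y hy using hS_zero hy.le
  rw [this.deriv_eq]; simp

lemma hS_deriv_zero' {s : ℝ} (h : 2 < s) : deriv hS s = 0 := by
  have : hS =ᶠ[𝓝 s] fun _ => 1 := by
    filter_upwards [lt_mem_nhds h] with y hy using hS_one hy.le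
  rw [this.deriv_eq]; simp

lemma hS_abs (s : ℝ) : |hS s| ≤ 1 := abs_le.2
    ⟨(by norm_num : (-1:ℝ) ≤ 0).trans (Real.smoothTransition.nonneg _), Real.smoothTransition.le_one _⟩

lemma hS_deriv_hcs : HasCompactSupport (deriv hS) :=
  HasCompactSupport.intro (isCompact_Icc (a := (1:ℝ)) (b := 2)) (by
    intro s hs
    simp only [mem_Icc, not_and_or, not_le] at hs
    rcases hs with h | h
    · exact hS_deriv_zero h
    · exact hS_deriv_zero' h)

lemma hS_deriv_integrable : Integrable (deriv hS) :=
  hS_deriv_contDiff.continuous.integrable_of_hasCompactSupport hS_deriv_hcs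

lemma hS_integral : ∫ s, deriv hS s = 1 := by
  have := integral_of_hasDerivAt_of_tendsto (f := hS) (f' := deriv hS) (m := 0) (n := 1)
    (fun x => ((hS_contDiff.contDiffAt (x := x)).differentiableAt (by simp)).hasDerivAt)
    hS_deriv_integrable
    (tendsto_const_nhds.congr' (by
      filter_upwards [Iic_mem_atBot (1:ℝ)] with s hs using (hS_zero hs).symm))
    (tendsto_const_nhds.congr' (by
      filter_upwards [Ici_mem_atTop (2:ℝ)] with s hs using (hS_one hs).symm))
  simpa using this

lemma hS_integral_scaled {ε : ℝ} (hε : 0 < ε) : ∫ s, deriv hS (s / ε) / ε = 1 := by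
  rw [integral_div, Measure.integral_comp_div (deriv hS) ε, hS_integral, abs_of_pos hε]
  simp [hε.ne']

lemma hS_scaled_abs {ε : ℝ} (hε : 0 < ε) :
    ∫ s, |deriv hS (s / ε) / ε| = ∫ s, |deriv hS s| := by
  simp only [abs_div, abs_of_pos hε]
  rw [integral_div, Measure.integral_comp_div (fun s => |deriv hS s|) ε, abs_of_pos hε]
  simp [hε.ne']

lemma hS_scaled_integrable {ε : ℝ} (hε : 0 < ε) : Integrable (fun s => deriv hS (s / ε) / ε) :=
  ((hS_deriv_integrable).comp_div hε.ne').div_const ε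

lemma heat_slice {H : ℝ × ℝ → ℝ} (hm : Measurable H) {M : ℝ} (hM : ∀ w, |H w| ≤ M)
    (hc : ContinuousAt H 0) :
    Tendsto (fun σ : ℝ => ∫ a, H (a, σ) * hK (a, σ)) (𝓝[>] 0) (𝓝 (H 0)) := by
  have hpi := Real.sqrt_pos.2 Real.pi_pos
  have e : ∀ σ : ℝ, 0 < σ → ∫ a, H (a, σ) * hK (a, σ) =
      ∫ v, H (√(4 * σ) * v, σ) * ((√Real.pi)⁻¹ * Real.exp (-1 * v ^ 2)) := by
    intro σ hσ
    have hcpos : 0 < √(4 * σ) := Real.sqrt_pos.2 (by positivity)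
    have h1 := Measure.integral_comp_mul_left (fun a => H (a, σ) * hK (a, σ)) (√(4 * σ))
    have h2 : ∫ a, H (a, σ) * hK (a, σ) = √(4 * σ) * ∫ v, H (√(4 * σ) * v, σ) * hK (√(4 * σ) * v, σ) := by
      rw [h1, abs_of_pos (by positivity), smul_eq_mul, ← mul_assoc, mul_inv_cancel₀ hcpos.ne', one_mul]
    rw [h2, ← integral_const_mul]
    congr 1; funext v
    have e2 : √(4 * Real.pi * σ) = √Real.pi * √(4 * σ) := by
      rw [← Real.sqrt_mul Real.pi_pos.le]; ring_nf
    simp only [hK, hσ, if_true]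
    rw [e2, mul_pow, Real.sq_sqrt (by positivity)]
    have : -(4 * σ * v ^ 2) / (4 * σ) = -1 * v ^ 2 := by field_simp
    rw [this, mul_inv]
    field_simp
  have lim : Tendsto (fun σ : ℝ => ∫ v, H (√(4 * σ) * v, σ) * ((√Real.pi)⁻¹ * Real.exp (-1 * v ^ 2)))
      (𝓝[>] 0) (𝓝 (∫ v, H 0 * ((√Real.pi)⁻¹ * Real.exp (-1 * v ^ 2)))) := by
    apply tendsto_integral_filter_of_dominated_convergence
      (fun v => M * ((√Real.pi)⁻¹ * Real.exp (-1 * v ^ 2)))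
    · filter_upwards with σ
      refine AEStronglyMeasurable.mul ?_ (by fun_prop : Continuous _).aestronglyMeasurable
      exact (hm.comp (by fun_prop)).aestronglyMeasurable
    · filter_upwards with σ
      filter_upwards with v
      rw [norm_mul, Real.norm_eq_abs, Real.norm_of_nonneg (by positivity : 0 ≤ (√Real.pi)⁻¹ * Real.exp (-1 * v ^ 2))]
      gcongr
      exact hM _
    · exact ((integrable_exp_neg_mul_sq one_pos).const_mul _).const_mul _
    · filter_upwards with v
      refine Tendsto.mul_const _ ?_
      have : Tendsto (fun σ : ℝ => (√(4 * σ) * v, σ)) (𝓝[>] 0) (𝓝 0) := by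
        have h : Continuous (fun σ : ℝ => (√(4 * σ) * v, σ)) := by fun_prop
        have := h.tendsto 0
        simp only [mul_zero, Real.sqrt_zero, zero_mul] at this
        exact this.mono_left nhdsWithin_le_nhds
      exact hc.tendsto.comp this
  rw [integral_const_mul, integral_const_mul, integral_gaussian, div_one, inv_mul_cancel₀ hpi.ne', mul_one] at lim
  refine lim.congr' ?_
  filter_upwards [self_mem_nhdsWithin] with σ hσ using (e σ hσ).symm

lemma heat_approx {H : ℝ × ℝ → ℝ} (hm : Measurable H) {M : ℝ} (hM : ∀ w, |H w| ≤ M)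
    (hc : ContinuousAt H 0)
    (hi : ∀ ε > 0, Integrable (fun w : ℝ × ℝ => H w * (deriv hS (w.2 / ε) / ε * hK w))) :
    Tendsto (fun ε : ℝ => ∫ w : ℝ × ℝ, H w * (deriv hS (w.2 / ε) / ε * hK w)) (𝓝[>] 0) (𝓝 (H 0)) := by
  have hB := heat_slice hm hM hc
  set B : ℝ → ℝ := fun σ => ∫ a, H (a, σ) * hK (a, σ) with hBdef
  set A := ∫ s, |deriv hS s| with hA
  have hA0 : 0 ≤ A := integral_nonneg fun _ => abs_nonneg _
  rw [Metric.tendsto_nhds]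
  intro δ hδ
  obtain ⟨δ', hδ', hlt⟩ : ∃ δ' > 0, δ' * A < δ := ⟨δ / (A + 1), by positivity, by
    rw [div_mul_eq_mul_div, div_lt_iff₀ (by positivity)]; nlinarith⟩
  have h1 := Metric.tendsto_nhds.1 hB δ' hδ'
  rw [eventually_nhdsWithin_iff, Metric.eventually_nhds_iff] at h1
  obtain ⟨s0, hs0, h1⟩ := h1
  have : ∀ᶠ ε : ℝ in 𝓝[>] 0, ε < s0 / 2 := nhdsWithin_le_nhds (gt_mem_nhds (by positivity))
  filter_upwards [this, self_mem_nhdsWithin] with ε h2 hε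
  have hε : 0 < ε := hε
  have hiε := hi ε hε
  have f1 : ∫ w : ℝ × ℝ, H w * (deriv hS (w.2 / ε) / ε * hK w) = ∫ σ, deriv hS (σ / ε) / ε * B σ := by
    rw [Measure.volume_eq_prod] at hiε ⊢
    rw [integral_prod_symm _ hiε]
    congr 1; funext σ
    rw [hBdef, ← integral_const_mul]
    congr 1; funext a; ring
  have f2 : Integrable (fun σ => deriv hS (σ / ε) / ε * B σ) := by
    rw [Measure.volume_eq_prod] at hiε
    refine hiε.integral_prod_right.congr (ae_of_all _ fun σ => ?_)
    simp only [hBdef]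
    rw [← integral_const_mul]
    congr 1; funext a; ring
  have f3 := hS_scaled_integrable hε
  have f4 : (∫ σ, deriv hS (σ / ε) / ε * B σ) - H 0 = ∫ σ, deriv hS (σ / ε) / ε * (B σ - H 0) := by
    simp only [mul_sub]
    rw [integral_sub f2 (f3.mul_const _), integral_mul_const, hS_integral_scaled hε, one_mul]
  rw [f1, Real.dist_eq, f4, ← Real.norm_eq_abs]
  refine lt_of_le_of_lt ?_ hlt
  rw [hA, ← hS_scaled_abs hε, ← integral_const_mul]
  refine norm_integral_le_of_norm_le (f3.abs.const_mul _) (ae_of_all _ fun σ => ?_)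
  rw [norm_mul, Real.norm_eq_abs, mul_comm]
  by_cases hz : deriv hS (σ / ε) = 0
  · simp [hz]
  have g1 : 1 ≤ σ / ε := by by_contra h; exact hz (hS_deriv_zero (not_le.1 h))
  have g2 : σ / ε ≤ 2 := by by_contra h; exact hz (hS_deriv_zero' (not_le.1 h))
  rw [le_div_iff₀ hε] at g1
  rw [div_le_iff₀ hε] at g2
  have g3 : (0:ℝ) < σ := by linarith
  have := h1 (y := σ) (by rw [Real.dist_eq, sub_zero, abs_of_pos g3]; linarith) g3
  gcongr
  exact this.le

lemma smooth_mul_away {c g : ℝ × ℝ → ℝ} (hc : ContDiff ℝ (⊤ : ℕ∞) c) (h0 : c =ᶠ[𝓝 0] fun _ => 0)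
    (hg : ContDiffOn ℝ (⊤ : ℕ∞) g {0}ᶜ) : ContDiff ℝ (⊤ : ℕ∞) (fun z => c z * g z) := by
  rw [contDiff_iff_contDiffAt]
  intro z
  by_cases hz : z = 0
  · subst hz
    have : (fun z => c z * g z) =ᶠ[𝓝 0] fun _ => 0 := by
      filter_upwards [h0] with w hw; simp [hw]
    exact contDiffAt_const.congr_of_eventuallyEq this
  · exact hc.contDiffAt.mul (hg.contDiffAt (isOpen_compl_singleton.mem_nhds hz))

/-- a cutoff equal to one near zero, supported in `[-r, r]` -/
noncomputable def hChi (r a : ℝ) : ℝ := 1 - hEta (2 * a / r)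

lemma hChi_contDiff (r : ℝ) : ContDiff ℝ (⊤ : ℕ∞) (hChi r) :=
  contDiff_const.sub (hEta_contDiff.comp (by fun_prop))

lemma hChi_one {r a : ℝ} (hr : 0 < r) (h : |a| ≤ r / 2) : hChi r a = 1 := by
  rw [hChi, hEta_zero, sub_zero]
  rw [abs_div, abs_mul, abs_two, abs_of_pos hr, div_le_one hr]; linarith

lemma hChi_zero {r a : ℝ} (hr : 0 < r) (h : r ≤ |a|) : hChi r a = 0 := by
  rw [hChi, hEta_one, sub_self]
  rw [div_pow, le_div_iff₀ (by positivity), mul_pow, ← sq_abs a]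
  nlinarith

lemma hChi_abs (r a : ℝ) : |hChi r a| ≤ 1 := by
  have h1 : 0 ≤ hEta (2 * a / r) := Real.smoothTransition.nonneg _
  have h2 : hEta (2 * a / r) ≤ 1 := Real.smoothTransition.le_one _
  rw [hChi, abs_le]; constructor <;> linarith

lemma hChi_deriv_contDiff (r : ℝ) : ContDiff ℝ (⊤ : ℕ∞) (deriv (hChi r)) :=
  (contDiff_infty_iff_deriv.1 (hChi_contDiff r)).2

lemma hChi_deriv2_contDiff (r : ℝ) : ContDiff ℝ (⊤ : ℕ∞) (deriv (deriv (hChi r))) :=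
  (contDiff_infty_iff_deriv.1 (hChi_deriv_contDiff r)).2

lemma hChi_deriv_in {r a : ℝ} (hr : 0 < r) (h : |a| < r / 2) : deriv (hChi r) a = 0 := by
  have : hChi r =ᶠ[𝓝 a] fun _ => 1 := by
    filter_upwards [continuous_abs.continuousAt.eventually (gt_mem_nhds h)] with y hy using hChi_one hr (le_of_lt hy)
  rw [this.deriv_eq]; simp

lemma hChi_deriv2_in {r a : ℝ} (hr : 0 < r) (h : |a| < r / 2) : deriv (deriv (hChi r)) a = 0 := by
  have : deriv (hChi r) =ᶠ[𝓝 a] fun _ => 0 := by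
    filter_upwards [continuous_abs.continuousAt.eventually (gt_mem_nhds h)] with y hy using hChi_deriv_in hr hy
  rw [this.deriv_eq]; simp

lemma hChi_deriv_out {r a : ℝ} (hr : 0 < r) (h : r < |a|) : deriv (hChi r) a = 0 := by
  have : hChi r =ᶠ[𝓝 a] fun _ => 0 := by
    filter_upwards [continuous_abs.continuousAt.eventually (lt_mem_nhds h)] with y hy using hChi_zero hr (le_of_lt hy)
  rw [this.deriv_eq]; simp

lemma hChi_deriv2_out {r a : ℝ} (hr : 0 < r) (h : r < |a|) : deriv (deriv (hChi r)) a = 0 := by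
  have : deriv (hChi r) =ᶠ[𝓝 a] fun _ => 0 := by
    filter_upwards [continuous_abs.continuousAt.eventually (lt_mem_nhds h)] with y hy using hChi_deriv_out hr hy
  rw [this.deriv_eq]; simp

/-- the smooth, compactly supported reproducing kernel -/
noncomputable def hOm (r : ℝ) (z : ℝ × ℝ) : ℝ :=
  (- deriv (hChi r) z.2 * hChi r z.1 + hChi r z.2 * deriv (deriv (hChi r)) z.1) * hK z
    + (2 * hChi r z.2 * deriv (hChi r) z.1) * hDx hK z

lemma hOm_contDiff {r : ℝ} (hr : 0 < r) : ContDiff ℝ (⊤ : ℕ∞) (hOm r) := by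
  have c0 := hChi_contDiff r
  have c1 := hChi_deriv_contDiff r
  have c2 := hChi_deriv2_contDiff r
  have n1 : ∀ᶠ w : ℝ × ℝ in 𝓝 0, |w.1| < r / 2 :=
    (by fun_prop : Continuous fun w : ℝ × ℝ => |w.1|).continuousAt.eventually (gt_mem_nhds (by simpa using hr))
  have n2 : ∀ᶠ w : ℝ × ℝ in 𝓝 0, |w.2| < r / 2 :=
    (by fun_prop : Continuous fun w : ℝ × ℝ => |w.2|).continuousAt.eventually (gt_mem_nhds (by simpa using hr))
  refine ContDiff.add (smooth_mul_away ?_ ?_ hK_contDiffOn)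
    (smooth_mul_away ?_ ?_ (hDx_contDiffOn isOpen_compl_singleton hK_contDiffOn))
  · exact (((c1.comp contDiff_snd).neg).mul (c0.comp contDiff_fst)).add
      ((c0.comp contDiff_snd).mul (c2.comp contDiff_fst))
  · filter_upwards [n1, n2] with w h1 h2
    rw [hChi_deriv_in hr h2, hChi_deriv2_in hr h1]; simp
  · exact (contDiff_const.mul (c0.comp contDiff_snd)).mul (c1.comp contDiff_fst)
  · filter_upwards [n1] with w h1
    rw [hChi_deriv_in hr h1]; simp

lemma box_hcs {g : ℝ × ℝ → ℝ} {r : ℝ} (h1 : ∀ z : ℝ × ℝ, r < |z.1| → g z = 0)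
    (h2 : ∀ z : ℝ × ℝ, r < |z.2| → g z = 0) : HasCompactSupport g := by
  refine HasCompactSupport.intro ((isCompact_Icc (a := -r) (b := r)).prod (isCompact_Icc (a := -r) (b := r))) ?_
  intro z hz
  rw [mem_prod, mem_Icc, mem_Icc, ← abs_le, ← abs_le, not_and_or, not_le, not_le] at hz
  exact hz.elim (h1 z) (h2 z)

lemma hOm_hcs {r : ℝ} (hr : 0 < r) : HasCompactSupport (hOm r) := by
  apply box_hcs (r := r)
  · intro z hz
    rw [hOm, hChi_zero hr hz.le, hChi_deriv_out hr hz, hChi_deriv2_out hr hz]; simp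
  · intro z hz
    rw [hOm, hChi_zero hr hz.le, hChi_deriv_out hr hz]; simp

lemma hOm_past {r : ℝ} {z : ℝ × ℝ} (hz : z.2 ≤ 0) : hOm r z = 0 := by
  have h1 : ∀ y, hK (y, z.2) = 0 := fun y => by simp [hK, not_lt.2 hz]
  have h2 : hK z = 0 := h1 z.1
  have h3 : hDx hK z = 0 := by simp [hDx, h1]
  rw [hOm, h2, h3]; simp

/-- truncated kernel -/
noncomputable def hKe (r ε : ℝ) (z : ℝ × ℝ) : ℝ := hS (z.2 / ε) * hChi r z.2 * hChi r z.1 * hK z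

lemma near_lt {ε : ℝ} {z : ℝ × ℝ} (h : z.2 < ε) : ∀ᶠ w : ℝ × ℝ in 𝓝 z, w.2 < ε :=
  continuous_snd.continuousAt.eventually (gt_mem_nhds h)

lemma hKe_contDiff {r ε : ℝ} (hε : 0 < ε) : ContDiff ℝ (⊤ : ℕ∞) (hKe r ε) := by
  have c0 := hChi_contDiff r
  refine smooth_mul_away ?_ ?_ hK_contDiffOn
  · exact ((hS_contDiff.comp (by fun_prop : ContDiff ℝ (⊤ : ℕ∞) fun z : ℝ × ℝ => z.2 / ε)).mul
      (c0.comp contDiff_snd)).mul (c0.comp contDiff_fst)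
  · filter_upwards [near_lt (z := 0) (ε := ε) hε] with w hw
    rw [hS_zero (by rw [div_le_one hε]; exact hw.le)]; simp

lemma hKe_L {r ε : ℝ} (hε : 0 < ε) (z : ℝ × ℝ) :
    - hDt (hKe r ε) z + hDx (hDx (hKe r ε)) z =
      hS (z.2 / ε) * hOm r z - hChi r z.1 * hChi r z.2 * (deriv hS (z.2 / ε) / ε * hK z) := by
  rcases le_or_gt z.2 0 with hz | hz
  · have h0 : hKe r ε =ᶠ[𝓝 z] fun _ => 0 := by
      filter_upwards [near_lt (z := z) (ε := ε) (by linarith)] with w hw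
      rw [hKe, hS_zero (by rw [div_le_one hε]; exact hw.le)]; simp
    rw [hDt_congr h0, hDx_congr (hDx_congr' h0), hDt_zero]
    have : hDx (fun _ => 0) = fun _ => 0 := funext hDx_zero
    rw [this, hDx_zero, hOm_past hz]
    have : hK z = 0 := by simp [hK, not_lt.2 hz]
    rw [this]; simp
  · obtain ⟨x, t⟩ := z
    simp only at hz
    have dχ : ∀ y, HasDerivAt (hChi r) (deriv (hChi r) y) y := fun y =>
      (((hChi_contDiff r).contDiffAt (x := y)).differentiableAt (by simp)).hasDerivAt
    have dχ1 : ∀ y, HasDerivAt (deriv (hChi r)) (deriv (deriv (hChi r)) y) y := fun y =>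
      (((hChi_deriv_contDiff r).contDiffAt (x := y)).differentiableAt (by simp)).hasDerivAt
    have dS : HasDerivAt (fun s => hS (s / ε)) (deriv hS (t / ε) / ε) t := by
      have h := (hS_contDiff.contDiffAt (x := t / ε)).differentiableAt (by simp)
      have := h.hasDerivAt.comp t ((hasDerivAt_id t).div_const ε)
      refine this.congr_deriv ?_
      simp [div_eq_mul_inv]
    have hne : ∀ y, (y, t) ∈ ({0}ᶜ : Set (ℝ × ℝ)) := by
      intro y hy
      have := congrArg Prod.snd (mem_singleton_iff.1 hy)
      simp at this; linarith
    have dd : ∀ (v : ℝ × ℝ → ℝ), ContDiffOn ℝ (⊤ : ℕ∞) v {0}ᶜ → ∀ y, DifferentiableAt ℝ v (y, t) :=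
      fun v hv y => (hv.contDiffAt (isOpen_compl_singleton.mem_nhds (hne y))).differentiableAt (by simp)
    have dx : ∀ (v : ℝ × ℝ → ℝ), ContDiffOn ℝ (⊤ : ℕ∞) v {0}ᶜ → ∀ y,
        HasDerivAt (fun y => v (y, t)) (hDx v (y, t)) y := by
      intro v hv y
      rw [hDx_eq (dd v hv y)]; exact hDx_hasDerivAt (dd v hv y)
    have dt : HasDerivAt (fun s => hK (x, s)) (hDt hK (x, t)) t := by
      rw [hDt_eq (dd _ hK_contDiffOn x)]; exact hDt_hasDerivAt (dd _ hK_contDiffOn x)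
    have e1 : hDt (hKe r ε) (x, t) = ((deriv hS (t / ε) / ε * hChi r t + hS (t / ε) * deriv (hChi r) t) * hChi r x) * hK (x, t)
        + hS (t / ε) * hChi r t * hChi r x * hDt hK (x, t) :=
      (((dS.mul (dχ t)).mul_const (hChi r x)).mul dt).deriv
    have e2 : (fun y => hDx (hKe r ε) (y, t)) = fun y =>
        (hS (t / ε) * hChi r t * deriv (hChi r) y) * hK (y, t) + hS (t / ε) * hChi r t * hChi r y * hDx hK (y, t) := by
      funext y
      exact (((dχ y).const_mul (hS (t / ε) * hChi r t)).mul (dx _ hK_contDiffOn y)).deriv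
    have e3 : hDx (hDx (hKe r ε)) (x, t) = ((hS (t / ε) * hChi r t * deriv (deriv (hChi r)) x) * hK (x, t)
         + hS (t / ε) * hChi r t * deriv (hChi r) x * hDx hK (x, t)) +
         ((hS (t / ε) * hChi r t * deriv (hChi r) x) * hDx hK (x, t)
         + hS (t / ε) * hChi r t * hChi r x * hDx (hDx hK) (x, t)) := by
      rw [hDx]; simp only [e2]
      exact ((((dχ1 x).const_mul (hS (t / ε) * hChi r t)).mul (dx _ hK_contDiffOn x)).add
        (((dχ x).const_mul (hS (t / ε) * hChi r t)).mul
          (dx _ (hDx_contDiffOn isOpen_compl_singleton hK_contDiffOn) x))).deriv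
    rw [e1, e3, hK_heat (z := (x, t)) hz, hOm]
    ring

lemma hDx_sub (k : ℝ × ℝ → ℝ) (z w : ℝ × ℝ) : hDx (fun w => k (z - w)) w = - hDx k (z - w) := by
  have := deriv_comp_const_sub (f := fun y => k (y, z.2 - w.2)) z.1 w.1
  exact this

lemma hDt_sub (k : ℝ × ℝ → ℝ) (z w : ℝ × ℝ) : hDt (fun w => k (z - w)) w = - hDt k (z - w) := by
  have := deriv_comp_const_sub (f := fun y => k (z.1 - w.1, y)) z.2 w.2
  exact this

lemma hDxx_sub (k : ℝ × ℝ → ℝ) (z w : ℝ × ℝ) :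
    hDx (hDx (fun w => k (z - w))) w = hDx (hDx k) (z - w) := by
  have : hDx (fun w => k (z - w)) = fun w => (fun v => - hDx k v) (z - w) := funext (hDx_sub k z)
  rw [this]
  refine (hDx_sub (fun v => - hDx k v) z w).trans ?_
  simp [hDx, deriv.fun_neg]

lemma heat_repr {Q : Set (ℝ × ℝ)} {u : ℝ × ℝ → ℝ} (hm : Measurable u) {M : ℝ} (hM : ∀ w, |u w| ≤ M)
    (hIntg : Integrable u)
    (hweak : ∀ φ : ℝ × ℝ → ℝ, ContDiff ℝ (⊤ : ℕ∞) φ → HasCompactSupport φ → tsupport φ ⊆ Q →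
      ∫ z, u z * (hDt φ z + hDx (hDx φ) z) = 0)
    {r : ℝ} (hr : 0 < r) {z : ℝ × ℝ} (hz : ∀ w : ℝ × ℝ, |w.1| ≤ r → |w.2| ≤ r → z - w ∈ Q)
    (hcont : ContinuousAt u z) :
    ∫ w, u w * hOm r (z - w) = u z := by
  have cS : Continuous hS := hS_contDiff.continuous
  have cS1 : Continuous (deriv hS) := hS_deriv_contDiff.continuous
  have cO : Continuous (hOm r) := (hOm_contDiff hr).continuous
  have cχ : Continuous (hChi r) := (hChi_contDiff r).continuous
  obtain ⟨BO, hBO⟩ := cO.bounded_above_of_compact_support (hOm_hcs hr)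
  -- the smooth test function at level ε
  have step : ∀ ε : ℝ, 0 < ε → ∫ w, u w * (hS ((z - w).2 / ε) * hOm r (z - w)) =
      ∫ w, u (z - w) * hChi r w.1 * hChi r w.2 * (deriv hS (w.2 / ε) / ε * hK w) ∧
      Integrable (fun w => u (z - w) * hChi r w.1 * hChi r w.2 * (deriv hS (w.2 / ε) / ε * hK w)) := by
    intro ε hε
    set g : ℝ × ℝ → ℝ := fun w => hChi r w.1 * hChi r w.2 * (deriv hS (w.2 / ε) / ε * hK w) with hg
    have hgs : Continuous g := by
      have : ContDiff ℝ (⊤ : ℕ∞) (fun w : ℝ × ℝ => (hChi r w.1 * hChi r w.2 * (deriv hS (w.2 / ε) / ε)) * hK w) := by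
        refine smooth_mul_away ?_ ?_ hK_contDiffOn
        · exact (((hChi_contDiff r).comp contDiff_fst).mul ((hChi_contDiff r).comp contDiff_snd)).mul
            ((hS_deriv_contDiff.comp (by fun_prop : ContDiff ℝ (⊤ : ℕ∞) fun z : ℝ × ℝ => z.2 / ε)).div_const ε)
        · filter_upwards [near_lt (z := 0) (ε := ε) hε] with w hw
          rw [hS_deriv_zero (by rw [div_lt_one hε]; exact hw)]; simp
      have h2 := this.continuous
      have e : g = fun w : ℝ × ℝ => (hChi r w.1 * hChi r w.2 * (deriv hS (w.2 / ε) / ε)) * hK w := by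
        funext w; simp only [hg]; ring
      rw [e]; exact h2
    have hgc : HasCompactSupport g := by
      apply box_hcs (r := r)
      · intro w hw; simp [hg, hChi_zero hr hw.le]
      · intro w hw; simp [hg, hChi_zero hr hw.le]
    obtain ⟨Bg, hBg⟩ := hgs.bounded_above_of_compact_support hgc
    have hkc : HasCompactSupport (hKe r ε) := by
      apply box_hcs (r := r)
      · intro w hw; simp [hKe, hChi_zero hr hw.le]
      · intro w hw; simp [hKe, hChi_zero hr hw.le]
    have hφ : ContDiff ℝ (⊤ : ℕ∞) (fun w => hKe r ε (z - w)) :=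
      (hKe_contDiff hε).comp (contDiff_const.sub contDiff_id)
    have hφ0 : ∀ w, w ∉ {w : ℝ × ℝ | |(z - w).1| ≤ r ∧ |(z - w).2| ≤ r} → hKe r ε (z - w) = 0 := by
      intro w hw
      rw [mem_ofPred_eq, not_and_or, not_le, not_le] at hw
      rcases hw with hw | hw <;> simp only [hKe, hChi_zero hr hw.le] <;> simp
    have hclosed : IsClosed {w : ℝ × ℝ | |(z - w).1| ≤ r ∧ |(z - w).2| ≤ r} := by
      have h1 : IsClosed {w : ℝ × ℝ | |(z - w).1| ≤ r} := isClosed_le (by fun_prop) (by fun_prop)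
      have h2 : IsClosed {w : ℝ × ℝ | |(z - w).2| ≤ r} := isClosed_le (by fun_prop) (by fun_prop)
      exact h1.inter h2
    have hφc : HasCompactSupport (fun w => hKe r ε (z - w)) :=
      hkc.comp_homeomorph (Homeomorph.subLeft z)
    have hφs : tsupport (fun w => hKe r ε (z - w)) ⊆ Q := by
      intro w hw
      have : w ∈ {w : ℝ × ℝ | |(z - w).1| ≤ r ∧ |(z - w).2| ≤ r} := by
        refine closure_minimal ?_ hclosed hw
        intro v hv
        by_contra hcon
        exact hv (hφ0 v hcon)
      have := hz (z - w) this.1 this.2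
      simpa using this
    have h0 := hweak _ hφ hφc hφs
    have e0 : ∀ w, hDt (fun w => hKe r ε (z - w)) w + hDx (hDx (fun w => hKe r ε (z - w))) w =
        hS ((z - w).2 / ε) * hOm r (z - w) - g (z - w) := by
      intro w
      rw [hDt_sub, hDxx_sub, hKe_L hε]
    simp only [e0, mul_sub] at h0
    have i1 : Integrable (fun w => u w * (hS ((z - w).2 / ε) * hOm r (z - w))) := by
      refine int_mul_bdd hIntg BO (by fun_prop) fun w => ?_
      rw [norm_mul, Real.norm_eq_abs (hS _)]
      have := mul_le_mul_of_nonneg_right (hS_abs ((z - w).2 / ε)) (norm_nonneg (hOm r (z - w)))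
      linarith [hBO (z - w)]
    have i2 : Integrable (fun w => u w * g (z - w)) :=
      int_mul_bdd hIntg Bg (by fun_prop) fun w => hBg _
    rw [integral_sub i1 i2, sub_eq_zero] at h0
    have e3 : (fun w => u (z - w) * hChi r w.1 * hChi r w.2 * (deriv hS (w.2 / ε) / ε * hK w)) =
        fun w => u (z - w) * g w := by funext w; simp only [hg]; ring
    rw [e3]
    constructor
    · rw [h0, ← integral_sub_left_eq_self _ volume z]
      simp
    · exact int_mul_bdd (hIntg.comp_sub_left z) Bg hgs hBg
  have lim1 : Tendsto (fun ε : ℝ => ∫ w, u w * (hS ((z - w).2 / ε) * hOm r (z - w))) (𝓝[>] 0)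
      (𝓝 (∫ w, u w * hOm r (z - w))) := by
    apply tendsto_integral_filter_of_dominated_convergence (fun w => |u w * hOm r (z - w)|)
    · filter_upwards with ε
      exact hIntg.aestronglyMeasurable.mul (by fun_prop : Continuous _).aestronglyMeasurable
    · filter_upwards with ε
      filter_upwards with w
      rw [Real.norm_eq_abs, abs_mul, abs_mul, abs_mul]
      have := mul_le_mul_of_nonneg_right (hS_abs ((z - w).2 / ε)) (abs_nonneg (hOm r (z - w)))
      gcongr; linarith
    · exact (int_mul_bdd hIntg BO (by fun_prop) fun w => hBO (z - w)).abs
    · filter_upwards with w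
      rcases le_or_gt (z - w).2 0 with h | h
      · simp [hOm_past h]
      · apply tendsto_const_nhds.congr'
        have : ∀ᶠ ε : ℝ in 𝓝[>] 0, ε < (z - w).2 / 2 :=
          nhdsWithin_le_nhds (gt_mem_nhds (by positivity))
        filter_upwards [this, self_mem_nhdsWithin] with ε h1 h2
        have h2 : 0 < ε := h2
        rw [hS_one, one_mul]
        rw [le_div_iff₀ h2]; linarith
  have lim2 := heat_approx (H := fun w => u (z - w) * hChi r w.1 * hChi r w.2) (M := M) ?_ ?_ ?_
    (fun ε hε => (step ε hε).2)
  · have e : u (z - 0) * hChi r (0 : ℝ × ℝ).1 * hChi r (0 : ℝ × ℝ).2 = u z := by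
      have : hChi r 0 = 1 := hChi_one hr (by simp; positivity)
      simp [this]
    rw [e] at lim2
    refine tendsto_nhds_unique lim1 (lim2.congr' ?_)
    filter_upwards [self_mem_nhdsWithin] with ε hε using (step ε hε).1.symm
  · exact ((hm.comp (by fun_prop)).mul (by fun_prop : Continuous _).measurable).mul (by fun_prop : Continuous _).measurable
  · intro w
    rw [abs_mul, abs_mul]
    have h1 := hChi_abs r w.1
    have h2 := hChi_abs r w.2
    have h3 := hM (z - w)
    have : |hChi r w.1| * |hChi r w.2| ≤ 1 := mul_le_one₀ h1 (abs_nonneg _) h2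
    rw [mul_assoc]
    nlinarith [abs_nonneg (u (z - w))]
  · have h1 : ContinuousAt (fun w : ℝ × ℝ => u (z - w)) 0 := by
      apply ContinuousAt.comp (g := u)
      · simpa using hcont
      · fun_prop
    exact (h1.mul (by fun_prop)).mul (by fun_prop)

lemma slice_decay {g : ℝ → ℝ} (hg : Measurable g) {M : ℝ} (hM : ∀ x, |g x| ≤ M)
    (hodd : ∀ x, g (-x) = - g x) {τ κ C : ℝ} (hτ : 0 < τ)
    (h : ∫ x in (0:ℝ)..τ, (g x) ^ 2 ≤ C * τ ^ (2 * κ + 1)) :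
    ∫ x in Ioo (-τ) τ, |g x| ≤ (C + 1) * τ ^ (κ + 1) := by
  have i1 : ∀ a b : ℝ, IntervalIntegrable (fun x => |g x|) volume a b := by
    intro a b
    rw [intervalIntegrable_iff, uIoc]
    refine Integrable.of_bound (by fun_prop) M (ae_of_all _ fun x => ?_)
    simpa using hM x
  have i2 : IntervalIntegrable (fun x => g x ^ 2) volume 0 τ := by
    rw [intervalIntegrable_iff, uIoc]
    refine Integrable.of_bound (by fun_prop) (M ^ 2) (ae_of_all _ fun x => ?_)
    rw [Real.norm_eq_abs, abs_pow]
    exact pow_le_pow_left₀ (abs_nonneg _) (hM x) 2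
  have e1 : ∫ x in Ioo (-τ) τ, |g x| = ∫ x in (-τ)..τ, |g x| := by
    rw [intervalIntegral.integral_of_le (by linarith), integral_Ioc_eq_integral_Ioo]
  have e2 : ∫ x in (-τ)..0, |g x| = ∫ x in (0:ℝ)..τ, |g x| := by
    have := intervalIntegral.integral_comp_neg (a := 0) (b := τ) (fun x => |g x|)
    simp only [hodd, abs_neg, neg_zero] at this
    exact this.symm
  rw [e1, ← intervalIntegral.integral_add_adjacent_intervals (i1 (-τ) 0) (i1 0 τ), e2]
  have hp : 0 < τ ^ κ := Real.rpow_pos_of_pos hτ κ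
  have key : ∫ x in (0:ℝ)..τ, |g x| ≤ ∫ x in (0:ℝ)..τ, ((τ ^ κ)⁻¹ / 2 * g x ^ 2 + τ ^ κ / 2) := by
    refine intervalIntegral.integral_mono_on hτ.le (i1 0 τ)
      ((i2.const_mul _).add intervalIntegrable_const) fun x _ => ?_
    have h3 : (τ ^ κ)⁻¹ / 2 * g x ^ 2 + τ ^ κ / 2 - |g x| = (τ ^ κ)⁻¹ / 2 * (|g x| - τ ^ κ) ^ 2 := by
      rw [← sq_abs (g x)]; field_simp; ring
    have h4 : 0 ≤ (τ ^ κ)⁻¹ / 2 * (|g x| - τ ^ κ) ^ 2 := by positivity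
    linarith
  rw [intervalIntegral.integral_add (i2.const_mul _) intervalIntegrable_const,
    intervalIntegral.integral_const_mul, intervalIntegral.integral_const] at key
  have h5 := mul_le_mul_of_nonneg_left h (show 0 ≤ (τ ^ κ)⁻¹ / 2 by positivity)
  have h6 : τ ^ (2 * κ + 1) = τ ^ κ * τ ^ κ * τ := by
    rw [Real.rpow_add hτ, two_mul, Real.rpow_add hτ, Real.rpow_one]
  have h7 : τ ^ (κ + 1) = τ ^ κ * τ := by rw [Real.rpow_add hτ, Real.rpow_one]
  rw [h6] at h5
  rw [h7]
  have h8 : (τ ^ κ)⁻¹ / 2 * (C * (τ ^ κ * τ ^ κ * τ)) = C * (τ ^ κ * τ) / 2 := by field_simp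
  rw [h8] at h5
  simp only [sub_zero, smul_eq_mul] at key
  linarith

lemma strip_decay {u : ℝ × ℝ → ℝ} (hm : Measurable u) {M : ℝ} (hM : ∀ w, |u w| ≤ M)
    (hIntg : Integrable u) (hodd : ∀ x t, u (-x, t) = - u (x, t)) {a b κ C : ℝ} (hab : a ≤ b)
    (hκ : 0 < κ)
    (hsup : ∀ x t, t ∉ Ioo a b → u (x, t) = 0)
    (h : ∀ τ ∈ Ioo (0:ℝ) (1/4), ∀ t ∈ Ioo a b,
      ∫ x in (0:ℝ)..τ, (u (x, t)) ^ 2 ≤ C * τ ^ (2 * κ + 1)) :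
    Tendsto (fun τ : ℝ => τ⁻¹ * ∫ z in {z : ℝ × ℝ | |z.1| < τ}, |u z|) (𝓝[>] 0) (𝓝 0) := by
  have hlim : Tendsto (fun τ : ℝ => (b - a) * (C + 1) * τ ^ κ) (𝓝[>] 0) (𝓝 0) := by
    have : Tendsto (fun τ : ℝ => (b - a) * (C + 1) * τ ^ κ) (𝓝 0) (𝓝 ((b - a) * (C + 1) * 0 ^ κ)) :=
      ((Real.continuousAt_rpow_const 0 κ (Or.inr hκ.le)).tendsto).const_mul _
    rw [Real.zero_rpow hκ.ne', mul_zero] at this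
    exact this.mono_left nhdsWithin_le_nhds
  refine squeeze_zero' ?_ ?_ hlim
  · filter_upwards [self_mem_nhdsWithin] with τ hτ
    exact mul_nonneg (inv_nonneg.2 (le_of_lt hτ)) (integral_nonneg fun _ => abs_nonneg _)
  · filter_upwards [Ioo_mem_nhdsGT (show (0:ℝ) < 1/4 by norm_num)] with τ hτ
    have hms : MeasurableSet {z : ℝ × ℝ | |z.1| < τ} := measurableSet_lt (by fun_prop) (by fun_prop)
    have hi : Integrable ({z : ℝ × ℝ | |z.1| < τ}.indicator fun z => |u z|) := hIntg.abs.indicator hms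
    have hi' : Integrable ({z : ℝ × ℝ | |z.1| < τ}.indicator fun z => |u z|)
      ((volume : Measure ℝ).prod volume) := hi
    have e : ∫ z in {z : ℝ × ℝ | |z.1| < τ}, |u z| =
        ∫ t : ℝ, ∫ x in Ioo (-τ) τ, |u (x, t)| := by
      rw [← integral_indicator hms]
      rw [Measure.volume_eq_prod, integral_prod_symm _ hi']
      refine integral_congr_ae (ae_of_all _ fun t => ?_)
      simp only
      rw [← integral_indicator measurableSet_Ioo]
      refine integral_congr_ae (ae_of_all _ fun x => ?_)
      by_cases hx : |x| < τ
      · have h1 : ((x, t) : ℝ × ℝ) ∈ {z : ℝ × ℝ | |z.1| < τ} := hx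
        have h2 : x ∈ Ioo (-τ) τ := abs_lt.1 hx
        simp only [indicator_of_mem h1, indicator_of_mem h2]
      · have h1 : ((x, t) : ℝ × ℝ) ∉ {z : ℝ × ℝ | |z.1| < τ} := hx
        have h2 : x ∉ Ioo (-τ) τ := fun h => hx (abs_lt.2 h)
        simp only [indicator_of_notMem h1, indicator_of_notMem h2]
    have hle : ∫ t : ℝ, ∫ x in Ioo (-τ) τ, |u (x, t)| ≤
        ∫ t : ℝ, (Ioo a b).indicator (fun _ => (C + 1) * τ ^ (κ + 1)) t := by
      refine integral_mono_of_nonneg (ae_of_all _ fun t => integral_nonneg fun _ => abs_nonneg _) ?_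
        (ae_of_all _ fun t => ?_)
      · rw [integrable_indicator_iff measurableSet_Ioo]
        exact integrableOn_const (by simp)
      · by_cases ht : t ∈ Ioo a b
        · simp only [indicator_of_mem ht]
          exact slice_decay (by fun_prop) (fun x => hM (x, t)) (fun x => hodd x t) hτ.1 (h τ hτ t ht)
        · simp [indicator_of_notMem ht, hsup _ t ht]
    rw [integral_indicator measurableSet_Ioo, setIntegral_const, measureReal_def, Real.volume_Ioo,
      ENNReal.toReal_ofReal (by linarith), smul_eq_mul] at hle
    rw [e]
    calc τ⁻¹ * _ ≤ τ⁻¹ * _ := mul_le_mul_of_nonneg_left hle (inv_nonneg.2 hτ.1.le)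
      _ = _ := by
        rw [Real.rpow_add hτ.1, Real.rpow_one]
        have := hτ.1.ne'
        field_simp

lemma heat_smooth {Q : Set (ℝ × ℝ)} (hQ : IsOpen Q) {u : ℝ × ℝ → ℝ} (hm : Measurable u) {M : ℝ}
    (hM : ∀ w, |u w| ≤ M) (hIntg : Integrable u) (hodd : ∀ x t, u (-x, t) = - u (x, t))
    (hu : ContDiffOn ℝ (⊤ : ℕ∞) u (Q ∩ {z | z.1 ≠ 0}))
    (hweak : ∀ φ : ℝ × ℝ → ℝ, ContDiff ℝ (⊤ : ℕ∞) φ → HasCompactSupport φ → tsupport φ ⊆ Q →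
      ∫ z, u z * (hDt φ z + hDx (hDx φ) z) = 0) : ContDiffOn ℝ (⊤ : ℕ∞) u Q := by
  have hU : IsOpen (Q ∩ {z : ℝ × ℝ | z.1 ≠ 0}) :=
    hQ.inter (isOpen_ne_fun (by fun_prop) (by fun_prop))
  intro z0 hz0
  refine ContDiffAt.contDiffWithinAt ?_
  by_cases h0 : z0.1 = 0
  swap
  · exact hu.contDiffAt (hU.mem_nhds ⟨hz0, h0⟩)
  obtain ⟨ε, hε, hball⟩ := Metric.isOpen_iff.1 hQ z0 hz0
  have hr : 0 < ε / 2 := by linarith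
  set v : ℝ × ℝ → ℝ := fun z => ∫ w, u w * hOm (ε / 2) (z - w) with hv
  have hvs : ContDiff ℝ (⊤ : ℕ∞) v :=
    (hOm_hcs hr).contDiff_convolution_right (ContinuousLinearMap.mul ℝ ℝ) hIntg.locallyIntegrable
      (hOm_contDiff hr)
  have hne : ∀ z ∈ Metric.ball z0 (ε / 2), z.1 ≠ 0 → v z = u z := by
    intro z hz hz1
    have hzQ : z ∈ Q := hball (Metric.ball_subset_ball (by linarith) hz)
    refine heat_repr hm hM hIntg hweak hr ?_ ((hu.contDiffAt (hU.mem_nhds ⟨hzQ, hz1⟩)).continuousAt)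
    intro w h1 h2
    apply hball
    rw [Metric.mem_ball] at hz ⊢
    have : dist (z - w) z ≤ ε / 2 := by
      rw [dist_eq_norm, sub_sub_cancel_left, norm_neg, Prod.norm_def]
      exact max_le h1 h2
    linarith [dist_triangle (z - w) z z0]
  have heq : ∀ z ∈ Metric.ball z0 (ε / 2), v z = u z := by
    intro z hz
    by_cases hz1 : z.1 = 0
    swap
    · exact hne z hz hz1
    obtain ⟨x, t⟩ := z
    simp only at hz1
    subst hz1
    have hu0 : u (0, t) = 0 := by
      have := hodd 0 t
      rw [neg_zero] at this; linarith
    rw [hu0]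
    have hcv := hvs.continuous
    have hc : Continuous (fun x : ℝ => v (x, t) + v (-x, t)) := by fun_prop
    have l1 : Tendsto (fun x : ℝ => v (x, t) + v (-x, t)) (𝓝[≠] 0) (𝓝 (v (0, t) + v (-0, t))) :=
      (hc.tendsto 0).mono_left nhdsWithin_le_nhds
    have n1 : ∀ᶠ x : ℝ in 𝓝 0, (x, t) ∈ Metric.ball z0 (ε / 2) :=
      (show Continuous fun x : ℝ => (x, t) by fun_prop).continuousAt.eventually_mem
        (Metric.isOpen_ball.mem_nhds hz)
    have n2 : ∀ᶠ x : ℝ in 𝓝 0, (-x, t) ∈ Metric.ball z0 (ε / 2) :=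
      (show Continuous fun x : ℝ => (-x, t) by fun_prop).continuousAt.eventually_mem
        (Metric.isOpen_ball.mem_nhds (by simpa using hz))
    have l2 : Tendsto (fun x : ℝ => v (x, t) + v (-x, t)) (𝓝[≠] 0) (𝓝 0) := by
      refine tendsto_const_nhds.congr' ?_
      filter_upwards [n1.filter_mono nhdsWithin_le_nhds, n2.filter_mono nhdsWithin_le_nhds,
        self_mem_nhdsWithin] with x h1 h2 h3
      rw [hne _ h1 h3, hne _ h2 (neg_ne_zero.2 h3), hodd]; ring
    have := tendsto_nhds_unique l1 l2
    rw [neg_zero] at this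
    linarith
  refine hvs.contDiffAt.congr_of_eventuallyEq ?_
  filter_upwards [Metric.ball_mem_nhds z0 hr] with z hz using (heq z hz).symm

lemma heat_ext {Q : Set (ℝ × ℝ)} (hQ : IsOpen Q) {u : ℝ × ℝ → ℝ}
    (hu : ContDiffOn ℝ (⊤ : ℕ∞) u Q)
    (hh : ∀ z ∈ Q ∩ {z | z.1 ≠ 0}, hDt u z = hDx (hDx u) z) : ∀ z ∈ Q, hDt u z = hDx (hDx u) z := by
  intro z hz
  by_cases h0 : z.1 = 0
  swap
  · exact hh z ⟨hz, h0⟩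
  have c1 : ContinuousAt (hDt u) z :=
    ((hDt_contDiffOn hQ hu).contDiffAt (hQ.mem_nhds hz)).continuousAt
  have c2 : ContinuousAt (hDx (hDx u)) z :=
    ((hDx_contDiffOn hQ (hDx_contDiffOn hQ hu)).contDiffAt (hQ.mem_nhds hz)).continuousAt
  obtain ⟨x, t⟩ := z
  simp only at h0
  subst h0
  have hp : Tendsto (fun x : ℝ => (x, t)) (𝓝[≠] 0) (𝓝 (0, t)) :=
    ((show Continuous fun x : ℝ => (x, t) by fun_prop).tendsto 0).mono_left nhdsWithin_le_nhds
  have l1 := c1.tendsto.comp hp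
  have l2 := c2.tendsto.comp hp
  refine tendsto_nhds_unique (l1.congr' ?_) l2
  filter_upwards [hp.eventually (hQ.mem_nhds hz), self_mem_nhdsWithin] with x h1 h2
  exact hh _ ⟨h1, h2⟩

/-- Analytic core of Proposition 7.5: a bounded smooth solution of the heat equation on
`(0,1) × (5/4,5/2)` with quantitative L² decay `∫₀^τ f² dx ≤ C τ^{2κ+1}` has an odd
reflection across `x = 0` which solves the heat equation weakly on `(−1,1) × (5/4,5/2)`,
agrees a.e. with a smooth solution there, and in particular `f` extends continuously to
`x = 0` with boundary value `0`. -/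
theorem odd_reflection_heat
    (κ C : ℝ) (hκ : κ ∈ Ioo (0:ℝ) 1) (hC : 0 < C)
    (f F : ℝ → ℝ → ℝ)
    (hsmooth : ContDiffOn ℝ (⊤ : ℕ∞) (fun p : ℝ × ℝ => f p.1 p.2)
      (Ioo (0:ℝ) 1 ×ˢ Ioo (5/4 : ℝ) (5/2)))
    (hbdd : ∃ M : ℝ, ∀ x ∈ Ioo (0:ℝ) 1, ∀ t ∈ Ioo (5/4 : ℝ) (5/2), |f x t| ≤ M)
    (hheat : ∀ x ∈ Ioo (0:ℝ) 1, ∀ t ∈ Ioo (5/4 : ℝ) (5/2),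
      deriv (fun τ => f x τ) t = deriv (deriv (fun y => f y t)) x)
    (hdecay : ∀ τ ∈ Ioo (0:ℝ) (1/4), ∀ t ∈ Ioo (5/4 : ℝ) (5/2),
      ∫ x in (0:ℝ)..τ, (f x t) ^ 2 ≤ C * τ ^ (2 * κ + 1))
    (hFpos : ∀ x ∈ Ioo (0:ℝ) 1, ∀ t : ℝ, F x t = f x t)
    (hF0 : ∀ t : ℝ, F 0 t = 0)
    (hFneg : ∀ x ∈ Ioo (-1 : ℝ) 0, ∀ t : ℝ, F x t = - f (-x) t) :
    (∀ φ : ℝ → ℝ → ℝ,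
      ContDiff ℝ (⊤ : ℕ∞) (fun p : ℝ × ℝ => φ p.1 p.2) →
      HasCompactSupport (fun p : ℝ × ℝ => φ p.1 p.2) →
      tsupport (fun p : ℝ × ℝ => φ p.1 p.2) ⊆ Ioo (-1 : ℝ) 1 ×ˢ Ioo (5/4 : ℝ) (5/2) →
      ∫ p in Ioo (-1 : ℝ) 1 ×ˢ Ioo (5/4 : ℝ) (5/2),
        F p.1 p.2 * (deriv (fun τ => φ p.1 τ) p.2 + deriv (deriv (fun y => φ y p.2)) p.1)
        = 0)
    ∧ ∃ G : ℝ → ℝ → ℝ,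
        ContDiffOn ℝ (⊤ : ℕ∞) (fun p : ℝ × ℝ => G p.1 p.2)
          (Ioo (-1 : ℝ) 1 ×ˢ Ioo (5/4 : ℝ) (5/2)) ∧
        (∀ x ∈ Ioo (-1 : ℝ) 1, ∀ t ∈ Ioo (5/4 : ℝ) (5/2),
          deriv (fun τ => G x τ) t = deriv (deriv (fun y => G y t)) x) ∧
        (∀ᵐ p ∂(volume.restrict (Ioo (-1 : ℝ) 1 ×ˢ Ioo (5/4 : ℝ) (5/2))),
          F p.1 p.2 = G p.1 p.2) ∧
        (∀ t ∈ Ioo (5/4 : ℝ) (5/2),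
          Tendsto (fun x => f x t) (nhdsWithin 0 (Ioi (0:ℝ))) (nhds 0)) := by
  obtain ⟨M, hM⟩ := hbdd
  set Q : Set (ℝ × ℝ) := Ioo (-1 : ℝ) 1 ×ˢ Ioo (5/4 : ℝ) (5/2) with hQdef
  have hQ : IsOpen Q := isOpen_Ioo.prod isOpen_Ioo
  have hQm : MeasurableSet Q := hQ.measurableSet
  have hP : IsOpen (Ioo (0:ℝ) 1 ×ˢ Ioo (5/4 : ℝ) (5/2)) := isOpen_Ioo.prod isOpen_Ioo
  set u : ℝ × ℝ → ℝ := Q.indicator (fun p => F p.1 p.2) with hu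
  have huQ : ∀ z ∈ Q, u z = F z.1 z.2 := fun z hz => indicator_of_mem hz _
  have huP : ∀ z ∈ Ioo (0:ℝ) 1 ×ˢ Ioo (5/4 : ℝ) (5/2), u z = f z.1 z.2 := by
    intro z hz
    rw [huQ z ⟨⟨by linarith [hz.1.1], hz.1.2⟩, hz.2⟩, hFpos _ hz.1]
  have huN : ∀ z, z ∉ Q → u z = 0 := fun z hz => indicator_of_notMem hz _
  have hodd : ∀ x t, u (-x, t) = - u (x, t) := by
    intro x t
    by_cases hz : (x, t) ∈ Q
    · obtain ⟨⟨h1, h2⟩, ht⟩ := hz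
      simp only at h1 h2 ht
      rw [huQ (x, t) ⟨⟨h1, h2⟩, ht⟩, huQ (-x, t) ⟨⟨by simp only; linarith, by simp only; linarith⟩, ht⟩]
      rcases lt_trichotomy x 0 with h | h | h
      · simp only
        rw [hFneg x ⟨h1, h⟩, hFpos (-x) ⟨by linarith, by linarith⟩, neg_neg]
      · subst h; simp [hF0]
      · simp only
        rw [hFpos x ⟨h, h2⟩, hFneg (-x) ⟨by linarith, by linarith⟩, neg_neg]
    · have hz' : (-x, t) ∉ Q := by
        rintro ⟨⟨h1, h2⟩, ht⟩
        simp only at h1 h2 ht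
        exact hz ⟨⟨by simp only; linarith, by simp only; linarith⟩, ht⟩
      rw [huN _ hz, huN _ hz', neg_zero]
  have hodd' : u = fun z => - u (-z.1, z.2) := by
    funext z
    rw [hodd, neg_neg]
  have hu0 : ∀ t, u (0, t) = 0 := by
    intro t
    have := hodd 0 t
    rw [neg_zero] at this; linarith
  -- smoothness away from the axis
  have cP : ∀ z ∈ Ioo (0:ℝ) 1 ×ˢ Ioo (5/4 : ℝ) (5/2), u =ᶠ[𝓝 z] fun p => f p.1 p.2 := by
    intro z hz
    filter_upwards [hP.mem_nhds hz] with w hw using huP w hw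
  have sP : ∀ z ∈ Ioo (0:ℝ) 1 ×ˢ Ioo (5/4 : ℝ) (5/2), ContDiffAt ℝ (⊤ : ℕ∞) u z := by
    intro z hz
    exact (hsmooth.contDiffAt (hP.mem_nhds hz)).congr_of_eventuallyEq (cP z hz)
  have hRefl : ∀ z ∈ Q ∩ {z : ℝ × ℝ | z.1 ≠ 0}, z ∈ Ioo (0:ℝ) 1 ×ˢ Ioo (5/4 : ℝ) (5/2) ∨
      (-z.1, z.2) ∈ Ioo (0:ℝ) 1 ×ˢ Ioo (5/4 : ℝ) (5/2) := by
    rintro z ⟨⟨hx, ht⟩, hne⟩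
    rcases lt_or_gt_of_ne hne with h | h
    · right
      exact ⟨⟨by simp only; linarith, by simp only; linarith [hx.1]⟩, ht⟩
    · left
      exact ⟨⟨h, hx.2⟩, ht⟩
  have hus : ContDiffOn ℝ (⊤ : ℕ∞) u (Q ∩ {z | z.1 ≠ 0}) := by
    intro z hz
    refine ContDiffAt.contDiffWithinAt ?_
    rcases hRefl z hz with h | h
    · exact sP z h
    · rw [hodd']
      have h1 : ContDiffAt ℝ (⊤ : ℕ∞) (fun z : ℝ × ℝ => (-z.1, z.2)) z := by fun_prop
      exact ((sP _ h).comp z h1).neg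
  have hh1 : ∀ z ∈ Ioo (0:ℝ) 1 ×ˢ Ioo (5/4 : ℝ) (5/2), hDt u z = hDx (hDx u) z := by
    intro z hz
    rw [hDt_congr (cP z hz), hDx_congr (hDx_congr' (cP z hz))]
    exact hheat z.1 hz.1 z.2 hz.2
  have rx : ∀ z : ℝ × ℝ, hDx u z = hDx u (-z.1, z.2) := by
    intro z
    have h1 := deriv_comp_neg (fun y => u (y, z.2)) z.1
    have h2 : (fun y => u (y, z.2)) = fun y => - u (-y, z.2) := by
      funext y; rw [hodd, neg_neg]
    unfold hDx
    conv_lhs => rw [h2]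
    rw [deriv.fun_neg, h1, neg_neg]
  have rxx : ∀ z : ℝ × ℝ, hDx (hDx u) z = - hDx (hDx u) (-z.1, z.2) := by
    intro z
    have h1 := deriv_comp_neg (fun y => hDx u (y, z.2)) z.1
    have h2 : (fun y => hDx u (y, z.2)) = fun y => hDx u (-y, z.2) := by
      funext y; rw [rx]
    conv_lhs => unfold hDx
    change deriv (fun y => hDx u (y, z.2)) z.1 = _
    conv_lhs => rw [h2]
    rw [h1]; rfl
  have rt : ∀ z : ℝ × ℝ, hDt u z = - hDt u (-z.1, z.2) := by
    intro z
    have h2 : (fun s => u (z.1, s)) = fun s => - u (-z.1, s) := by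
      funext y; rw [hodd, neg_neg]
    conv_lhs => unfold hDt
    rw [h2, deriv.fun_neg]; rfl
  have hh : ∀ z ∈ Q ∩ {z | z.1 ≠ 0}, hDt u z = hDx (hDx u) z := by
    intro z hz
    rcases hRefl z hz with h | h
    · exact hh1 z h
    · rw [rt, rxx, hh1 _ h]
  have hbd : ∀ w, |u w| ≤ |M| := by
    have hb1 : ∀ z ∈ Ioo (0:ℝ) 1 ×ˢ Ioo (5/4 : ℝ) (5/2), |u z| ≤ |M| := by
      intro z hz
      rw [huP z hz]
      exact (hM _ hz.1 _ hz.2).trans (le_abs_self M)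
    intro w
    by_cases hw : w ∈ Q
    · by_cases h0 : w.1 = 0
      · have : w = (0, w.2) := Prod.ext h0 rfl
        rw [this, hu0]; simp
      · rcases hRefl w ⟨hw, h0⟩ with h | h
        · exact hb1 w h
        · have := hb1 _ h
          rw [hodd, abs_neg] at this
          exact this
    · rw [huN w hw]; simp
  have hU : IsOpen (Q ∩ {z : ℝ × ℝ | z.1 ≠ 0}) :=
    hQ.inter (isOpen_ne_fun (by fun_prop) (by fun_prop))
  have hmeas : Measurable u := by
    have e : u = (Q ∩ {z : ℝ × ℝ | z.1 ≠ 0}).piecewise u (fun _ => 0) := by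
      classical
      funext w
      by_cases hw : w ∈ Q ∩ {z : ℝ × ℝ | z.1 ≠ 0}
      · rw [piecewise_eq_of_mem _ _ _ hw]
      · rw [piecewise_eq_of_notMem _ _ _ hw]
        by_cases hq : w ∈ Q
        · have h0 : w.1 = 0 := by
            by_contra h0
            exact hw ⟨hq, h0⟩
          have : w = (0, w.2) := Prod.ext h0 rfl
          rw [this, hu0]
        · exact huN w hq
    rw [e]
    exact hus.continuousOn.measurable_piecewise continuousOn_const hU.measurableSet
  have hIntg : Integrable u := by
    have h1 : IntegrableOn u Q := by
      have : IsFiniteMeasure ((volume : Measure (ℝ × ℝ)).restrict Q) := by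
        refine ⟨?_⟩
        rw [Measure.restrict_apply_univ, hQdef, Measure.volume_eq_prod, Measure.prod_prod]
        simp [ENNReal.mul_lt_top]
      exact Integrable.of_bound hmeas.aestronglyMeasurable |M| (ae_of_all _ hbd)
    have h2 : u = Q.indicator u := by
      rw [hu, indicator_indicator, inter_self]
    rw [h2, integrable_indicator_iff hQm]
    exact h1
  have hdec : Tendsto (fun τ : ℝ => τ⁻¹ * ∫ z in {z : ℝ × ℝ | |z.1| < τ}, |u z|) (𝓝[>] 0) (𝓝 0) := by
    refine strip_decay (a := 5/4) (b := 5/2) (κ := κ) (C := C) hmeas hbd hIntg hodd (by norm_num) hκ.1 ?_ ?_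
    · intro x t ht
      exact huN _ fun h => ht h.2
    · intro τ hτ t ht
      refine le_trans (le_of_eq ?_) (hdecay τ hτ t ht)
      rw [intervalIntegral.integral_of_le hτ.1.le, intervalIntegral.integral_of_le hτ.1.le]
      refine setIntegral_congr_fun measurableSet_Ioc fun x hx => ?_
      rw [huP (x, t) ⟨⟨hx.1, by simp only; linarith [hx.2, hτ.2]⟩, ht⟩]
  have hweak : ∀ φ : ℝ × ℝ → ℝ, ContDiff ℝ (⊤ : ℕ∞) φ → HasCompactSupport φ → tsupport φ ⊆ Q →
      ∫ z, u z * (hDt φ z + hDx (hDx φ) z) = 0 :=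
    fun φ h1 h2 h3 => weak_heat hQ hus hh hodd hIntg hdec h1 h2 h3
  have hsm : ContDiffOn ℝ (⊤ : ℕ∞) u Q := heat_smooth hQ hmeas hbd hIntg hodd hus hweak
  have hhe := heat_ext hQ hsm hh
  have cQ : ∀ z ∈ Q, (fun p : ℝ × ℝ => F p.1 p.2) =ᶠ[𝓝 z] u := by
    intro z hz
    filter_upwards [hQ.mem_nhds hz] with w hw using (huQ w hw).symm
  refine ⟨?_, F, ?_, ?_, ?_, ?_⟩
  · intro φ h1 h2 h3
    rw [← hweak _ h1 h2 h3, ← integral_indicator hQm]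
    refine integral_congr_ae (ae_of_all _ fun z => ?_)
    by_cases hz : z ∈ Q
    · simp only [indicator_of_mem hz, huQ z hz]; rfl
    · simp only [indicator_of_notMem hz, huN z hz, zero_mul]
  · exact hsm.congr fun z hz => (huQ z hz).symm
  · intro x hx t ht
    have hz : (x, t) ∈ Q := ⟨hx, ht⟩
    have := hhe (x, t) hz
    rw [← hDt_congr (cQ _ hz), ← hDx_congr (hDx_congr' (cQ _ hz))] at this
    exact this
  · exact ae_of_all _ fun _ => rfl
  · intro t ht
    have hz : ((0:ℝ), t) ∈ Q := ⟨⟨by norm_num, by norm_num⟩, ht⟩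
    have hc : ContinuousAt u (0, t) := (hsm.contDiffAt (hQ.mem_nhds hz)).continuousAt
    have hp : Tendsto (fun x : ℝ => (x, t)) (𝓝[>] 0) (𝓝 (0, t)) :=
      ((show Continuous fun x : ℝ => (x, t) by fun_prop).tendsto 0).mono_left nhdsWithin_le_nhds
    have hl := hc.tendsto.comp hp
    rw [hu0] at hl
    refine hl.congr' ?_
    filter_upwards [Ioo_mem_nhdsGT (show (0:ℝ) < 1 by norm_num)] with x hx
    exact huP (x, t) ⟨hx, ht⟩
end

section
/- For j = 1,2,3 let s_j ∈ [−1/2, 1/2] and let f_j : [s_j,1] → ℝ be C¹ with f_j' absolutely continuous and f_j'' ∈ L²((s_j,1)). Assume: (i) f₁(s₁) + f₂(s₂) + f₃(s₃) = 0; (ii) f₁'(s₁) = f₂'(s₂) = f₃'(s₃); (iii) |f_j(1)| ≤ β and |f_j'(1)| ≤ β for j = 1,2,3, for some β ≥ 0; and (iv) |f_j'(x)| ≤ 1/2 for all x ∈ [s_j,1] and j = 1,2,3. Set α = ( Σ_{j=1}^{3} ∫_{s_j}^{1} f_j''(x)²·(1 + f_j'(x)²)^{−5/2} dx )^{1/2}.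 Then Σ_{j=1}^{3} ∫_{s_j}^{1} f_j'(x)² dx ≤ 3β² + 2α·( Σ_{j=1}^{3} ∫_{s_j}^{1} f_j(x)² dx )^{1/2}. -/
open MeasureTheory Set

/-- Integration by parts for two primitives of integrable functions. -/
theorem ibp_primitives {a b A B : ℝ} {u v : ℝ → ℝ}
    (hu : IntervalIntegrable u volume a b) (hv : IntervalIntegrable v volume a b) :
    ∫ x in a..b, (u x * (B + ∫ y in a..x, v y) + (A + ∫ y in a..x, u y) * v x)
      = (A + ∫ y in a..b, u y) * (B + ∫ y in a..b, v y) - A * B := by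
  have key : ∀ (C : ℝ) (w : ℝ → ℝ), IntervalIntegrable w volume a b →
      AbsolutelyContinuousOnInterval (fun x => C + ∫ y in a..x, w y) a b := by
    intro C w hw
    have h0 : AbsolutelyContinuousOnInterval (fun _ : ℝ => C) a b :=
      ((LipschitzWith.const C).lipschitzOnWith (s := uIcc a b)).absolutelyContinuousOnInterval
    exact h0.add (hw.absolutelyContinuousOnInterval_intervalIntegral (c := a) (by simp))
  have h := (key A u hu).integral_deriv_mul_eq_sub (key B v hv)
  simp only [intervalIntegral.integral_same, add_zero] at h
  rw [← h]
  apply intervalIntegral.integral_congr_ae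
  filter_upwards [hu.ae_hasDerivAt_integral, hv.ae_hasDerivAt_integral] with x h1 h2 hx
  have hx' := uIoc_subset_uIcc hx
  have e1 := ((h1 hx' a (by simp)).const_add A).deriv
  have e2 := ((h2 hx' a (by simp)).const_add B).deriv
  rw [e1, e2]

/-- One-branch integration by parts, with the relevant integrability. -/
theorem ibp_branch {a : ℝ} (ha : a ≤ 1) {f f' f'' : ℝ → ℝ}
    (hc : ContinuousOn f' (Icc a 1))
    (hd : ∀ x ∈ Icc a 1, HasDerivWithinAt f (f' x) (Icc a 1) x)
    (hi : IntervalIntegrable f'' volume a 1)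
    (hAC : ∀ x ∈ Icc a 1, f' x = f' a + ∫ y in a..x, f'' y) :
    IntervalIntegrable (fun x => f x * f'' x) volume a 1 ∧
    ∫ x in a..1, (f' x) ^ 2 = f 1 * f' 1 - f a * f' a - ∫ x in a..1, f x * f'' x := by
  have hfc : ContinuousOn f (Icc a 1) := fun x hx => (hd x hx).continuousWithinAt
  have hii : IntervalIntegrable f' volume a 1 := by
    apply ContinuousOn.intervalIntegrable; rwa [uIcc_of_le ha]
  have hf : ∀ x ∈ Icc a 1, f x = f a + ∫ y in a..x, f' y := by
    intro x hx
    have hsub : Icc a x ⊆ Icc a 1 := Icc_subset_Icc_right hx.2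
    have := intervalIntegral.integral_eq_sub_of_hasDeriv_right_of_le hx.1 (hfc.mono hsub)
      (f' := f') (fun y hy => (((hd y (hsub (Ioo_subset_Icc_self hy))).hasDerivAt
        (Icc_mem_nhds hy.1 (hy.2.trans_le hx.2))).hasDerivWithinAt))
      (by apply ContinuousOn.intervalIntegrable; rw [uIcc_of_le hx.1]; exact hc.mono hsub)
    linarith
  have hm : IntervalIntegrable (fun x => f x * f'' x) volume a 1 := by
    apply hi.continuousOn_mul; rwa [uIcc_of_le ha]
  refine ⟨hm, ?_⟩
  have h := ibp_primitives (A := f a) (B := f' a) hii hi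
  rw [← hf 1 ⟨ha, le_rfl⟩, ← hAC 1 ⟨ha, le_rfl⟩] at h
  have h2 : ∫ x in a..1, (f' x * (f' a + ∫ y in a..x, f'' y) + (f a + ∫ y in a..x, f' y) * f'' x)
      = ∫ x in a..1, ((f' x) ^ 2 + f x * f'' x) := by
    apply intervalIntegral.integral_congr
    intro x hx
    rw [uIcc_of_le ha] at hx
    simp only
    rw [← hf x hx, ← hAC x hx]; ring
  rw [h2, intervalIntegral.integral_add _ hm] at h
  · linarith
  · apply ContinuousOn.intervalIntegrable; rw [uIcc_of_le ha]; exact hc.pow 2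

theorem weight_bound {p : ℝ} (hp : |p| ≤ 1/2) : (1:ℝ)/4 ≤ (1 + p ^ 2) ^ (-(5:ℝ)/2) := by
  have h1 : p ^ 2 ≤ 1/4 := by
    have := sq_le_sq' (abs_le.mp hp).1 (abs_le.mp hp).2
    linarith
  have h0 : (1:ℝ) ≤ 1 + p ^ 2 := by nlinarith
  have h2 : (1 + p ^ 2) ^ (-(3:ℝ)) ≤ (1 + p ^ 2) ^ (-(5:ℝ)/2) :=
    Real.rpow_le_rpow_of_exponent_le h0 (by norm_num)
  refine le_trans ?_ h2
  rw [Real.rpow_neg (by positivity), show (3:ℝ) = ((3:ℕ):ℝ) by norm_num, Real.rpow_natCast,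
    one_div]
  apply inv_anti₀ (by positivity)
  calc (1 + p ^ 2) ^ 3 ≤ (5/4 : ℝ) ^ 3 := by gcongr; linarith
    _ ≤ 4 := by norm_num

/-- The integration-by-parts estimate (4.16) in the proof of Proposition 4.1:
for three C¹ graphs over `[s_j, 1]` with absolutely continuous derivatives and
L² second derivatives, meeting at a single point at 120° (conditions (i)–(ii)),
with endpoint smallness (iii) and gradient bound (iv),
`Σ_j ∫ f_j'² ≤ 3β² + 2α (Σ_j ∫ f_j²)^{1/2}`, where `α²` is the integral of the
squared curvature with respect to arclength along the three graphs. -/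
theorem integration_by_parts_estimate
    (s : Fin 3 → ℝ) (hs : ∀ j, s j ∈ Icc (-(1/2) : ℝ) (1/2))
    (f f' f'' : Fin 3 → ℝ → ℝ) (β : ℝ) (hβ : 0 ≤ β)
    (hf'cont : ∀ j, ContinuousOn (f' j) (Icc (s j) 1))
    (hderiv : ∀ j, ∀ x ∈ Icc (s j) 1, HasDerivWithinAt (f j) (f' j x) (Icc (s j) 1) x)
    (hf''int : ∀ j, IntervalIntegrable (f'' j) volume (s j) 1)
    (hAC : ∀ j, ∀ x ∈ Icc (s j) 1, f' j x = f' j (s j) + ∫ y in (s j)..x, f'' j y)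
    (hL2 : ∀ j, IntervalIntegrable (fun x => (f'' j x) ^ 2) volume (s j) 1)
    (hmeet : f 0 (s 0) + f 1 (s 1) + f 2 (s 2) = 0)
    (hangle : f' 0 (s 0) = f' 1 (s 1) ∧ f' 1 (s 1) = f' 2 (s 2))
    (hend : ∀ j, |f j 1| ≤ β ∧ |f' j 1| ≤ β)
    (hgrad : ∀ j, ∀ x ∈ Icc (s j) 1, |f' j x| ≤ 1/2) :
    ∑ j : Fin 3, ∫ x in (s j)..1, (f' j x) ^ 2
      ≤ 3 * β ^ 2
        + 2 * Real.sqrt (∑ j : Fin 3, ∫ x in (s j)..1,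
            (f'' j x) ^ 2 * (1 + (f' j x) ^ 2) ^ (-(5:ℝ)/2))
          * Real.sqrt (∑ j : Fin 3, ∫ x in (s j)..1, (f j x) ^ 2) := by
  have h1 : ∀ j, s j ≤ 1 := fun j => by have := (hs j).2; linarith
  have hb := fun j => ibp_branch (h1 j) (hf'cont j) (hderiv j) (hf''int j) (hAC j)
  have hB : ∀ j, IntervalIntegrable (fun x => (f j x) ^ 2) volume (s j) 1 := by
    intro j
    apply ContinuousOn.intervalIntegrable
    rw [uIcc_of_le (h1 j)]
    exact ContinuousOn.pow (fun x hx => (hderiv j x hx).continuousWithinAt) 2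
  set P := ∑ j : Fin 3, ∫ x in (s j)..1, (f'' j x) ^ 2 with hP
  set Q := ∑ j : Fin 3, ∫ x in (s j)..1, f j x * f'' j x with hQ
  set A := ∑ j : Fin 3, ∫ x in (s j)..1,
            (f'' j x) ^ 2 * (1 + (f' j x) ^ 2) ^ (-(5:ℝ)/2) with hA
  set B := ∑ j : Fin 3, ∫ x in (s j)..1, (f j x) ^ 2 with hBdef
  have hB0 : 0 ≤ B := Finset.sum_nonneg fun j _ =>
    intervalIntegral.integral_nonneg (h1 j) fun x _ => sq_nonneg _
  have hPA : P ≤ 4 * A := by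
    rw [hP, hA, Finset.mul_sum]
    apply Finset.sum_le_sum
    intro j _
    rw [← intervalIntegral.integral_const_mul]
    apply intervalIntegral.integral_mono_on (h1 j) (hL2 j)
    · apply IntervalIntegrable.const_mul
      apply (hL2 j).mul_continuousOn
      rw [uIcc_of_le (h1 j)]
      apply ContinuousOn.rpow_const
      · exact continuousOn_const.add ((hf'cont j).pow 2)
      · intro x _; left; positivity
    · intro x hx
      have := weight_bound (hgrad j x hx)
      nlinarith [mul_le_mul_of_nonneg_left this (sq_nonneg (f'' j x))]
  have hquad : ∀ t : ℝ, 0 ≤ B * (t * t) + (2 * Q) * t + P := by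
    intro t
    have hj : ∀ j, 0 ≤ t * t * (∫ x in (s j)..1, (f j x) ^ 2)
        + 2 * t * (∫ x in (s j)..1, f j x * f'' j x) + ∫ x in (s j)..1, (f'' j x) ^ 2 := by
      intro j
      rw [← intervalIntegral.integral_const_mul, ← intervalIntegral.integral_const_mul,
        ← intervalIntegral.integral_add ((hB j).const_mul _) ((hb j).1.const_mul _),
        ← intervalIntegral.integral_add
          (((hB j).const_mul _).add ((hb j).1.const_mul _)) (hL2 j)]
      apply intervalIntegral.integral_nonneg (h1 j)
      intro x _
      nlinarith [sq_nonneg (t * f j x + f'' j x)]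
    have := Finset.sum_nonneg (s := Finset.univ) fun j _ => hj j
    rw [Finset.sum_add_distrib, Finset.sum_add_distrib, ← Finset.mul_sum, ← Finset.mul_sum] at this
    linarith
  have hdisc := discrim_le_zero hquad
  rw [discrim] at hdisc
  have hQ2 : Q ^ 2 ≤ (4 * A) * B := by nlinarith [mul_le_mul_of_nonneg_right hPA hB0]
  have hQle : -Q ≤ 2 * √A * √B := by
    have hAB : 2 * √A * √B = √((4 * A) * B) := by
      rw [Real.sqrt_mul' _ hB0, Real.sqrt_mul (by norm_num)]
      rw [show (4:ℝ) = 2 ^ 2 by norm_num, Real.sqrt_sq (by norm_num)]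
    rw [hAB]
    exact (neg_le_abs Q).trans (Real.abs_le_sqrt hQ2)
  have hsum : ∑ j : Fin 3, ∫ x in (s j)..1, (f' j x) ^ 2
      = ∑ j : Fin 3, (f j 1 * f' j 1 - f j (s j) * f' j (s j)) - Q := by
    rw [hQ, ← Finset.sum_sub_distrib]
    exact Finset.sum_congr rfl fun j _ => (hb j).2
  have hbd : ∀ j, f j 1 * f' j 1 ≤ β ^ 2 := by
    intro j
    calc f j 1 * f' j 1 ≤ |f j 1| * |f' j 1| := by rw [← abs_mul]; exact le_abs_self _
      _ ≤ β * β := mul_le_mul (hend j).1 (hend j).2 (abs_nonneg _) hβ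
      _ = β ^ 2 := by ring
  have hz : f 0 (s 0) * f' 0 (s 0) + f 1 (s 1) * f' 1 (s 1) + f 2 (s 2) * f' 2 (s 2) = 0 := by
    rw [hangle.1, hangle.2, ← add_mul, ← add_mul, hmeet, zero_mul]
  rw [hsum, Fin.sum_univ_three]
  linarith [hbd 0, hbd 1, hbd 2]
end
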